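/- There exists a universal constant C > 0 such that for all n, m ≥ 1 and all ε, δ ∈ (0,1), setting k = ⌈C·(n^{2/3}·m^{1/3}·(log(1/δ))^{1/3}/ε^{4/3} + ((n·m·log(1/δ))^{1/2} + log(1/δ))/ε²)⌉, there exists a randomized tester A using k i.i.d. samples of the form (i,j) — where i is uniform on [m] and j is drawn from p^{(i)} — such that: for all tuples of PMFs p^{(1)},…,p^{(m)} on Fin n, if p^{(1)} = p^{(2)} = ⋯ = p^{(m)} then A outputs YES with probability at least 1 − δ, and if for every PMF q on Fin n one has (1/m)·∑_{i=1}^m d_TV(p^{(i)}, q) ≥ ε then A outputs YES with probability at most δ. -/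

import Mathlib

open scoped BigOperators

/-- `p` is a probability mass function on the finite type `α`. -/
def IsPMF {α : Type*} [Fintype α] (p : α → ℝ) : Prop :=
  (∀ a, 0 ≤ p a) ∧ ∑ a, p a = 1

/-- Total variation distance between two distributions on `Fin n`. -/
noncomputable def tvDist {n : ℕ} (p q : Fin n → ℝ) : ℝ :=
  (1 / 2) * ∑ j, |p j - q j|

/-- Probability that the randomized tester `A` outputs YES given `k` i.i.d. samples from `p`. -/
noncomputable def acceptProb1 {α : Type*} [Fintype α] {k : ℕ} (p : α → ℝ)
    (A : (Fin k → α) → ℝ) : ℝ :=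
  ∑ x : Fin k → α, (∏ i, p (x i)) * A x

/-- The joint sampling distribution on `Fin m × Fin n` induced by a collection of `m`
distributions on `Fin n`: the index `i` is uniform, and `j` is drawn from `p i`. -/
noncomputable def jointSampling {n m : ℕ} (p : Fin m → Fin n → ℝ) :
    Fin m × Fin n → ℝ :=
  fun ij => p ij.1 ij.2 / m

/-! ### Binomial expectation operator -/

/-- Expectation of `f (Bin(t,p))`. -/
noncomputable def Bn (p : ℝ) : ℕ → (ℕ → ℝ) → ℝ
  | 0, f => f 0
  | t + 1, f => (1 - p) * Bn p t f + p * Bn p t (fun x => f (x + 1))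

lemma Bn_mono {p : ℝ} (h0 : 0 ≤ p) (h1 : p ≤ 1) (t : ℕ) : ∀ {f g : ℕ → ℝ}, (∀ x, f x ≤ g x) →
    Bn p t f ≤ Bn p t g := by
  induction t with
  | zero => intro f g h; exact h 0
  | succ t ih =>
    intro f g h
    simp only [Bn]
    have a := ih h
    have b := ih (f := fun x => f (x+1)) (g := fun x => g (x+1)) (fun x => h (x+1))
    have h1' : 0 ≤ 1 - p := by linarith
    gcongr

lemma Bn_add (p : ℝ) (t : ℕ) : ∀ (f g : ℕ → ℝ),
    Bn p t (fun x => f x + g x) = Bn p t f + Bn p t g := by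
  induction t with
  | zero => intro f g; rfl
  | succ t ih =>
    intro f g
    simp only [Bn]
    rw [ih f g, ih (fun x => f (x+1)) (fun x => g (x+1))]
    ring

lemma Bn_smul (p : ℝ) (c : ℝ) (t : ℕ) : ∀ (f : ℕ → ℝ),
    Bn p t (fun x => c * f x) = c * Bn p t f := by
  induction t with
  | zero => intro f; rfl
  | succ t ih =>
    intro f
    simp only [Bn]
    rw [ih f, ih (fun x => f (x+1))]
    ring

lemma Bn_const (p : ℝ) (c : ℝ) (t : ℕ) : Bn p t (fun _ => c) = c := by
  induction t with
  | zero => rfl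
  | succ t ih => simp only [Bn, ih]; ring

lemma Bn_sub (p : ℝ) (t : ℕ) (f g : ℕ → ℝ) :
    Bn p t (fun x => f x - g x) = Bn p t f - Bn p t g := by
  have h := Bn_add p t f (fun x => (-1) * g x)
  rw [Bn_smul] at h
  have e : (fun x => f x - g x) = (fun x => f x + (-1) * g x) := by funext x; ring
  rw [e, h]; ring

lemma Bn_nonneg {p : ℝ} (h0 : 0 ≤ p) (h1 : p ≤ 1) (t : ℕ) {f : ℕ → ℝ} (h : ∀ x, 0 ≤ f x) :
    0 ≤ Bn p t f := by
  have := Bn_mono h0 h1 t h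
  rwa [Bn_const] at this

lemma Bn_pos {p : ℝ} (h0 : 0 ≤ p) (h1 : p ≤ 1) (t : ℕ) : ∀ {f : ℕ → ℝ}, (∀ x, 0 < f x) →
    0 < Bn p t f := by
  induction t with
  | zero => intro f h; exact h 0
  | succ t ih =>
    intro f h
    simp only [Bn]
    have a := ih h
    have b := ih (f := fun x => f (x+1)) (fun x => h (x+1))
    rcases lt_or_eq_of_le h1 with h | h
    · have : 0 < 1 - p := by linarith
      positivity
    · subst h; simpa using b

lemma Bn_geom (p z : ℝ) (t : ℕ) : Bn p t (fun x => z ^ x) = (1 - p + p * z) ^ t := by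
  induction t with
  | zero => simp [Bn]
  | succ t ih =>
    simp only [Bn, ih, pow_succ]
    have : Bn p t (fun x => z ^ x * z) = z * (1 - p + p * z) ^ t := by
      rw [← ih, ← Bn_smul]; congr 1; funext x; ring
    rw [this]; ring

lemma Bn_sq (p : ℝ) (t : ℕ) : ∀ c : ℝ, Bn p t (fun x => ((x:ℝ) - c)^2)
    = t * p * (1 - p) + (t * p - c)^2 := by
  induction t with
  | zero => intro c; simp [Bn]
  | succ t ih =>
    intro c
    simp only [Bn, ih]
    have : (fun x : ℕ => (((x + 1 : ℕ) : ℝ) - c)^2) = fun x : ℕ => ((x:ℝ) - (c - 1))^2 := by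
      funext x; push_cast; ring
    rw [this, ih]; push_cast; ring

lemma Bn_x_geom {p z : ℝ} (h0 : 0 ≤ p) (hz : 1 ≤ z) (t : ℕ) :
    Bn p t (fun x => (x:ℝ) * z ^ x) ≤ t * (p * z) * (1 - p + p * z) ^ t := by
  have hu : 1 ≤ 1 - p + p * z := by nlinarith
  induction t with
  | zero => simp [Bn]
  | succ t ih =>
    simp only [Bn]
    have e : (fun x : ℕ => ((x + 1 : ℕ) : ℝ) * z ^ (x+1))
      = fun x : ℕ => z * ((x:ℝ) * z ^ x) + z * z ^ x := by
      funext x; push_cast; ring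
    rw [e, Bn_add, Bn_smul, Bn_smul, Bn_geom]
    set u := 1 - p + p * z with hud
    set R := Bn p t (fun x => (x:ℝ) * z ^ x)
    have hpz : 0 ≤ p * z := by positivity
    have hut : 0 ≤ u ^ t := by positivity
    have e2 : (1 - p) * R + p * (z * R + z * u ^ t) = u * R + p * z * u ^ t := by rw [hud]; ring
    rw [e2]
    calc u * R + p * z * u ^ t ≤ u * (t * (p * z) * u ^ t) + p * z * u ^ t * u := by
          have : p * z * u ^ t * 1 ≤ p * z * u ^ t * u := by gcongr
          have h2 : u * R ≤ u * (t * (p * z) * u ^ t) := by gcongr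
          linarith
      _ = _ := by push_cast; ring

lemma Bn_xx_geom {p z : ℝ} (h0 : 0 ≤ p) (hz : 1 ≤ z) (t : ℕ) :
    Bn p t (fun x => (x:ℝ) * (x - 1) * z ^ x) ≤ (t * (p * z))^2 * (1 - p + p * z) ^ t := by
  have hu : 1 ≤ 1 - p + p * z := by nlinarith
  induction t with
  | zero => simp [Bn]
  | succ t ih =>
    simp only [Bn]
    have e : (fun x : ℕ => ((x + 1 : ℕ) : ℝ) * ((x + 1 : ℕ) - 1) * z ^ (x+1))
      = fun x : ℕ => z * ((x:ℝ) * (x - 1) * z ^ x) + (2 * z) * (x * z ^ x) := by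
      funext x; push_cast; ring
    rw [e, Bn_add, Bn_smul, Bn_smul]
    have hx := Bn_x_geom h0 hz t
    set u := 1 - p + p * z with hud
    set R := Bn p t (fun x => (x:ℝ) * z ^ x)
    set Q := Bn p t (fun x => (x:ℝ) * (x - 1) * z ^ x)
    have hpz : 0 ≤ p * z := by positivity
    have hut : 0 ≤ u ^ t := by positivity
    have e2 : (1 - p) * Q + p * (z * Q + 2 * z * R) = u * Q + 2 * (p * z) * R := by rw [hud]; ring
    rw [e2]
    calc u * Q + 2 * (p * z) * R
        ≤ u * ((t * (p * z))^2 * u ^ t) + 2 * (p * z) * (t * (p * z) * u ^ t) := by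
          gcongr
      _ ≤ u * ((t * (p * z))^2 * u ^ t) + 2 * (p * z) * (t * (p * z) * u ^ t) * u
            + (p * z)^2 * u ^ t * u := by
          have : 2 * (p * z) * (t * (p * z) * u ^ t) * 1 ≤ 2 * (p * z) * (t * (p * z) * u ^ t) * u := by
            gcongr
          have h3 : 0 ≤ (p * z)^2 * u ^ t * u := by positivity
          linarith
      _ = _ := by push_cast; ring

lemma exp_quad {y : ℝ} (h : |y| ≤ 1) : Real.exp y ≤ 1 + y + y^2 := by
  have := Real.abs_exp_sub_one_sub_id_le h
  have := (abs_le.mp this).2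
  linarith

/-- Lipschitz mgf bound. -/
lemma Bn_exp_lip {p lam : ℝ} (h0 : 0 ≤ p) (h1 : p ≤ 1) (hl : |lam| ≤ 1) (t : ℕ) :
    ∀ {f : ℕ → ℝ}, (∀ x, f x ≤ f (x+1)) → (∀ x, f (x+1) ≤ f x + 1) →
    Bn p t (fun x => Real.exp (lam * f x)) ≤ Real.exp (lam * Bn p t f + lam^2 * (t * p)) := by
  -- generalised: peel from the inside
  induction t with
  | zero => intro f _ _; simp [Bn]
  | succ t ih =>
    intro f hm hL
    have key : Bn p (t+1) (fun x => Real.exp (lam * f x))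
        = Bn p t (fun x => (1-p) * Real.exp (lam * f x) + p * Real.exp (lam * f (x+1))) := by
      rw [Bn_add, Bn_smul, Bn_smul]; rfl
    have key2 : Bn p (t+1) f = Bn p t (fun x => (1-p) * f x + p * f (x+1)) := by
      rw [Bn_add, Bn_smul, Bn_smul]; rfl
    rw [key, key2]
    set h : ℕ → ℝ := fun x => (1-p) * f x + p * f (x+1) with hh
    have hm' : ∀ x, h x ≤ h (x+1) := by
      intro x
      have := hm x; have := hm (x+1)
      have h1' : 0 ≤ 1 - p := by linarith
      simp only [hh]; gcongr
    have hL' : ∀ x, h (x+1) ≤ h x + 1 := by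
      intro x
      have a := hL x; have b := hL (x+1)
      simp only [hh]; nlinarith
    have step : Bn p t (fun x => (1-p) * Real.exp (lam * f x) + p * Real.exp (lam * f (x+1)))
        ≤ Bn p t (fun x => Real.exp (lam^2 * p) * Real.exp (lam * h x)) := by
      apply Bn_mono h0 h1
      intro x
      have a := hL x; have b := hm x
      set d := f (x+1) - f x with hd
      have hd0 : 0 ≤ d := by linarith
      have hd1 : d ≤ 1 := by linarith
      have e1 : f (x+1) = f x + d := by rw [hd]; ring
      have habs : |lam * d| ≤ 1 := by
        rw [abs_mul, abs_of_nonneg hd0]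
        have := abs_nonneg lam
        nlinarith
      have q := exp_quad habs
      have e2 : (1-p) * Real.exp (lam * f x) + p * Real.exp (lam * f (x+1))
          = Real.exp (lam * f x) * (1 + p * (Real.exp (lam * d) - 1)) := by
        rw [e1, mul_add, Real.exp_add]; ring
      have e3 : Real.exp (lam^2 * p) * Real.exp (lam * h x)
          = Real.exp (lam * f x) * Real.exp (p * (lam * d + lam^2)) := by
        rw [← Real.exp_add, ← Real.exp_add]; congr 1
        simp only [hh]; rw [e1]; ring
      rw [e2, e3]
      apply mul_le_mul_of_nonneg_left _ (Real.exp_pos _).le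
      have : p * (Real.exp (lam * d) - 1) ≤ p * (lam * d + lam^2) := by
        apply mul_le_mul_of_nonneg_left _ h0
        have : (lam*d)^2 ≤ lam^2 := by
          rw [mul_pow]
          have : d^2 ≤ 1 := by nlinarith
          nlinarith [sq_nonneg lam]
        linarith
      have := Real.add_one_le_exp (p * (lam * d + lam^2))
      linarith
    refine step.trans ?_
    rw [Bn_smul]
    calc _ ≤ Real.exp (lam^2 * p) * Real.exp (lam * Bn p t h + lam^2 * (t * p)) := by
          apply mul_le_mul_of_nonneg_left (ih hm' hL') (Real.exp_pos _).le
      _ = _ := by rw [← Real.exp_add]; congr 1; push_cast; ring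

/-- Second moment lower-tail mgf bound. -/
lemma Bn_exp_neg {p lam : ℝ} (h0 : 0 ≤ p) (h1 : p ≤ 1) (hl : 0 ≤ lam) (t : ℕ)
    {f : ℕ → ℝ} (hf0 : ∀ x, 0 ≤ f x) (hf1 : ∀ x, f x ^ 2 ≤ x * (x - 1)) :
    Bn p t (fun x => Real.exp (-lam * f x)) ≤ Real.exp (-lam * Bn p t f + lam^2 * (t * p)^2) := by
  have b2 : Bn p t (fun x => (x:ℝ) * (x-1)) ≤ (t*p)^2 := by
    have := Bn_xx_geom (z := 1) h0 le_rfl t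
    simpa using this
  have : Bn p t (fun x => Real.exp (-lam * f x)) ≤
      Bn p t (fun x => 1 + (-lam * f x + lam^2 * (x * (x-1)))) := by
    apply Bn_mono h0 h1
    intro x
    have hy : 0 ≤ lam * f x := mul_nonneg hl (hf0 x)
    have hq : Real.exp (-(lam * f x)) ≤ 1 - lam * f x + (lam * f x)^2 := by
      by_cases hc : lam * f x ≤ 1
      · have := exp_quad (y := -(lam * f x)) (by rw [abs_neg, abs_of_nonneg hy]; exact hc)
        nlinarith
      · have : Real.exp (-(lam * f x)) ≤ 1 := Real.exp_le_one_iff.mpr (by linarith)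
        nlinarith
    have : (lam * f x)^2 ≤ lam^2 * (x * (x-1)) := by
      rw [mul_pow]; exact mul_le_mul_of_nonneg_left (hf1 x) (sq_nonneg _)
    have e : -lam * f x = -(lam * f x) := by ring
    rw [e]; linarith
  refine this.trans ?_
  rw [Bn_add, Bn_add, Bn_smul, Bn_smul, Bn_const]
  have h3 : lam^2 * Bn p t (fun x => (x:ℝ) * (x-1)) ≤ lam^2 * (t*p)^2 :=
    mul_le_mul_of_nonneg_left b2 (sq_nonneg _)
  have := Real.add_one_le_exp (-lam * Bn p t f + lam^2 * (t * p)^2)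
  linarith

/-- Second moment upper-tail mgf bound when `t p ≤ 1`. -/
lemma Bn_exp_pos {p lam : ℝ} (h0 : 0 ≤ p) (h1 : p ≤ 1) (hl : 0 ≤ lam) (hl1 : lam ≤ 1) (t : ℕ)
    (htp : t * p ≤ 1)
    {f : ℕ → ℝ} (hf0 : ∀ x, 0 ≤ f x) (hfx : ∀ x, f x ≤ x) (hf1 : ∀ x, f x ^ 2 ≤ x * (x - 1)) :
    Bn p t (fun x => Real.exp (lam * f x)) ≤ Real.exp (lam * Bn p t f + 81 * lam^2 * (t * p)^2) := by
  have he : Real.exp 1 ≤ 3 := by have := Real.exp_one_lt_d9; linarith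
  have b2 : Bn p t (fun x => (x:ℝ) * (x-1) * (Real.exp 1)^x) ≤ 81 * (t*p)^2 := by
    have hz : 1 ≤ Real.exp 1 := by
      have := Real.add_one_le_exp (1:ℝ); linarith
    refine (Bn_xx_geom h0 hz t).trans ?_
    have hu : (1 - p + p * Real.exp 1)^t ≤ 9 := by
      calc (1 - p + p * Real.exp 1)^t ≤ (Real.exp (2 * p))^t := by
            gcongr
            have := Real.add_one_le_exp (2*p)
            nlinarith
        _ = Real.exp (2 * (t * p)) := by rw [← Real.exp_nat_mul]; ring_nf
        _ ≤ Real.exp (1 + 1) := by apply Real.exp_le_exp.mpr; linarith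
        _ ≤ 9 := by rw [Real.exp_add]; nlinarith [Real.exp_pos 1]
    have hu0 : 0 ≤ (1 - p + p * Real.exp 1)^t := by
      apply pow_nonneg; nlinarith
    have h9 : (t * (p * Real.exp 1))^2 ≤ 9 * (t*p)^2 := by
      have e : (t * (p * Real.exp 1))^2 = (Real.exp 1)^2 * (t*p)^2 := by ring
      rw [e]
      have : (Real.exp 1)^2 ≤ 9 := by nlinarith [Real.exp_pos 1]
      gcongr
    calc _ ≤ (9 * (t*p)^2) * 9 := by gcongr
      _ = _ := by ring
  have : Bn p t (fun x => Real.exp (lam * f x)) ≤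
      Bn p t (fun x => 1 + (lam * f x + lam^2 * (x * (x-1) * (Real.exp 1)^x))) := by
    apply Bn_mono h0 h1
    intro x
    have hy : 0 ≤ lam * f x := mul_nonneg hl (hf0 x)
    have hyx : lam * f x ≤ x := by
      have := hfx x; have := hf0 x; nlinarith
    have hq : Real.exp (lam * f x) ≤ 1 + lam * f x + (lam * f x)^2 * (Real.exp 1)^x := by
      have hex : (Real.exp 1)^x = Real.exp x := by rw [← Real.exp_nat_mul]; simp
      rw [hex]
      have h1x : 1 ≤ Real.exp x := Real.one_le_exp (by positivity)
      by_cases hc : lam * f x ≤ 1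
      · have := exp_quad (y := lam * f x) (by rw [abs_of_nonneg hy]; exact hc)
        nlinarith [sq_nonneg (lam * f x)]
      · have h2 : Real.exp (lam * f x) ≤ Real.exp x := Real.exp_le_exp.mpr hyx
        have : 1 ≤ (lam * f x)^2 := by nlinarith
        nlinarith
    have : (lam * f x)^2 * (Real.exp 1)^x ≤ lam^2 * (x * (x-1) * (Real.exp 1)^x) := by
      rw [mul_pow, mul_assoc]
      apply mul_le_mul_of_nonneg_left _ (sq_nonneg _)
      apply mul_le_mul_of_nonneg_right (hf1 x) (by positivity)
    linarith
  refine this.trans ?_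
  rw [Bn_add, Bn_add, Bn_smul, Bn_smul, Bn_const]
  have h3 := mul_le_mul_of_nonneg_left b2 (sq_nonneg lam)
  have := Real.add_one_le_exp (lam * Bn p t f + 81 * lam^2 * (t * p)^2)
  linarith

/-! ### Expectation over lists of i.i.d. samples -/

/-- Expectation of `f` over lists of `t` i.i.d. samples from `p`. -/
noncomputable def ex {ι : Type*} [Fintype ι] (p : ι → ℝ) : ℕ → (List ι → ℝ) → ℝ
  | 0, f => f []
  | t + 1, f => ∑ i, p i * ex p t (fun l => f (i :: l))

section exlemmas
variable {ι : Type*} [Fintype ι]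

lemma ex_mono {p : ι → ℝ} (hp : ∀ i, 0 ≤ p i) (t : ℕ) : ∀ {f g : List ι → ℝ},
    (∀ l, l.length = t → f l ≤ g l) → ex p t f ≤ ex p t g := by
  induction t with
  | zero => intro f g h; exact h [] rfl
  | succ t ih =>
    intro f g h
    simp only [ex]
    apply Finset.sum_le_sum
    intro i _
    apply mul_le_mul_of_nonneg_left _ (hp i)
    apply ih
    intro l hl
    exact h _ (by simp [hl])

lemma ex_congr {p : ι → ℝ} (t : ℕ) : ∀ {f g : List ι → ℝ},
    (∀ l, l.length = t → f l = g l) → ex p t f = ex p t g := by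
  induction t with
  | zero => intro f g h; exact h [] rfl
  | succ t ih =>
    intro f g h
    simp only [ex]
    apply Finset.sum_congr rfl
    intro i _
    congr 1
    apply ih
    intro l hl
    exact h _ (by simp [hl])

lemma ex_smul (p : ι → ℝ) (c : ℝ) (t : ℕ) : ∀ (f : List ι → ℝ),
    ex p t (fun l => c * f l) = c * ex p t f := by
  induction t with
  | zero => intro f; rfl
  | succ t ih =>
    intro f
    simp only [ex]
    rw [Finset.mul_sum]
    apply Finset.sum_congr rfl
    intro i _
    rw [ih (fun l => f (i :: l))]; ring

lemma ex_sum (p : ι → ℝ) {κ : Type*} (s : Finset κ) (t : ℕ) : ∀ (f : κ → List ι → ℝ),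
    ex p t (fun l => ∑ a ∈ s, f a l) = ∑ a ∈ s, ex p t (f a) := by
  induction t with
  | zero => intro f; rfl
  | succ t ih =>
    intro f
    simp only [ex]
    rw [Finset.sum_comm]
    apply Finset.sum_congr rfl
    intro i _
    rw [ih (fun a l => f a (i :: l)), Finset.mul_sum]

lemma ex_const {p : ι → ℝ} (hp : ∑ i, p i = 1) (c : ℝ) (t : ℕ) : ex p t (fun _ => c) = c := by
  induction t with
  | zero => rfl
  | succ t ih =>
    simp only [ex, ih]
    rw [← Finset.sum_mul, hp, one_mul]

lemma ex_append (p : ι → ℝ) (b : ℕ) (h : List ι → ℝ) (a : ℕ) : ∀ (f : List ι → ℝ),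
    ex p (a + b) (fun l => f (l.take a) * h (l.drop a)) = ex p a f * ex p b h := by
  induction a with
  | zero => intro f; simp [ex, ex_smul]
  | succ a ih =>
    intro f
    have e : a + 1 + b = (a + b) + 1 := by ring
    rw [e]
    simp only [ex, List.take_succ_cons, List.drop_succ_cons]
    rw [Finset.sum_mul]
    apply Finset.sum_congr rfl
    intro i _
    rw [ih (fun l => f (i :: l))]; ring

lemma ex_eq_sum (p : ι → ℝ) (k : ℕ) : ∀ (f : List ι → ℝ),
    ex p k f = ∑ x : Fin k → ι, (∏ s, p (x s)) * f (List.ofFn x) := by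
  induction k with
  | zero => intro f; simp [ex]
  | succ k ih =>
    intro f
    simp only [ex]
    rw [← (Fin.consEquiv (fun _ => ι)).sum_comp, Fintype.sum_prod_type]
    apply Finset.sum_congr rfl
    intro i _
    rw [ih, Finset.mul_sum]
    apply Finset.sum_congr rfl
    intro x _
    simp [Fin.consEquiv, Fin.prod_univ_succ, List.ofFn_succ]
    ring

lemma prod_one_sub_ge (s : Finset ι) (a d : ι → ℝ) (ha : ∀ i, 0 < a i)
    (h : (∀ i, 0 ≤ d i ∧ d i ≤ a i) ∨ (∀ i, d i ≤ 0)) [DecidableEq ι] :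
    ∏ i ∈ s, a i - ∑ i ∈ s, d i * ∏ l ∈ s.erase i, a l ≤ ∏ i ∈ s, (a i - d i) := by
  have hP : ∀ i ∈ s, ∏ l ∈ s.erase i, a l = (∏ l ∈ s, a l) / a i := by
    intro i hi
    rw [← Finset.mul_prod_erase s a hi]
    field_simp [(ha i).ne']
  have e1 : ∑ i ∈ s, d i * ∏ l ∈ s.erase i, a l = (∏ l ∈ s, a l) * ∑ i ∈ s, d i / a i := by
    rw [Finset.mul_sum]
    apply Finset.sum_congr rfl
    intro i hi
    rw [hP i hi]; ring
  have e2 : ∏ i ∈ s, (a i - d i) = (∏ l ∈ s, a l) * ∏ i ∈ s, (1 - d i / a i) := by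
    rw [← Finset.prod_mul_distrib]
    apply Finset.prod_congr rfl
    intro i _
    have := (ha i).ne'
    field_simp
  rw [e1, e2]
  have hpos : 0 < ∏ l ∈ s, a l := Finset.prod_pos (fun i _ => ha i)
  have key : 1 - ∑ i ∈ s, d i / a i ≤ ∏ i ∈ s, (1 - d i / a i) := by
    rcases h with h | h
    · have hd : ∀ i, 0 ≤ d i / a i ∧ d i / a i ≤ 1 := fun i =>
        ⟨div_nonneg (h i).1 (ha i).le, (div_le_one (ha i)).mpr (h i).2⟩
      have : 1 - ∑ i ∈ s, d i / a i ≤ ∏ i ∈ s, (1 - d i / a i) ∧ 0 ≤ ∏ i ∈ s, (1 - d i / a i)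
          ∧ ∏ i ∈ s, (1 - d i / a i) ≤ 1 := by
        induction s using Finset.induction_on with
        | empty => simp
        | insert i s hi ih =>
          rw [Finset.sum_insert hi, Finset.prod_insert hi]
          have ih' := ih (fun i hi => by
              rw [← Finset.mul_prod_erase s a hi]; field_simp [(ha i).ne'])
            (by rw [Finset.mul_sum]
                apply Finset.sum_congr rfl
                intro i hi
                rw [← Finset.mul_prod_erase s a hi]; field_simp [(ha i).ne'])
            (by rw [← Finset.prod_mul_distrib]
                apply Finset.prod_congr rfl
                intro i _
                have := (ha i).ne'
                field_simp)
            (Finset.prod_pos (fun i _ => ha i))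
          obtain ⟨i1, i2, i3⟩ := ih'
          have := hd i
          refine ⟨by nlinarith, by apply mul_nonneg <;> linarith, by nlinarith⟩
      exact this.1
    · have hd : ∀ i, d i / a i ≤ 0 := fun i => div_nonpos_of_nonpos_of_nonneg (h i) (ha i).le
      clear e1 e2 hP hpos
      have : 1 - ∑ i ∈ s, d i / a i ≤ ∏ i ∈ s, (1 - d i / a i) ∧ ∑ i ∈ s, d i / a i ≤ 0 := by
        induction s using Finset.induction_on with
        | empty => simp
        | insert i s hi ih =>
          rw [Finset.sum_insert hi, Finset.prod_insert hi]
          obtain ⟨i1, i2⟩ := ih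
          have := hd i
          refine ⟨by nlinarith, by linarith⟩
      exact this.1
  calc _ = (∏ l ∈ s, a l) * (1 - ∑ i ∈ s, d i / a i) := by ring
    _ ≤ _ := mul_le_mul_of_nonneg_left key hpos.le

/-- Negative association of multinomial counts (product form). -/
lemma ex_na [DecidableEq ι] {p : ι → ℝ} (hp : ∀ i, 0 ≤ p i) (hs : ∑ i, p i = 1) (t : ℕ) :
    ∀ {g : ι → ℕ → ℝ}, (∀ i x, 0 < g i x) →
    ((∀ i, Monotone (g i)) ∨ (∀ i, Antitone (g i))) →
    ex p t (fun l => ∏ i, g i (l.count i)) ≤ ∏ i, Bn (p i) t (g i) := by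
  have hp1 : ∀ i, p i ≤ 1 := fun i => by
    rw [← hs]; exact Finset.single_le_sum (fun j _ => hp j) (Finset.mem_univ i)
  induction t with
  | zero => intro g _ _; simp [ex, Bn]
  | succ t ih =>
    intro g hg hm
    simp only [ex]
    have step : ∀ i, ex p t (fun l => ∏ i', g i' ((i :: l).count i'))
        ≤ Bn (p i) t (fun x => g i (x+1)) * ∏ l ∈ Finset.univ.erase i, Bn (p l) t (g l) := by
      intro i
      let g' : ι → ℕ → ℝ := Function.update g i (fun x => g i (x+1))
      have e : (fun l : List ι => ∏ i', g i' ((i :: l).count i'))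
          = fun l => ∏ i', g' i' (l.count i') := by
        funext l
        apply Finset.prod_congr rfl
        intro i' _
        by_cases h : i' = i
        · subst h; simp [g']
        · have h' : ¬ i = i' := fun hh => h hh.symm
          simp [g', h, h']
      rw [e]
      have hmm : (∀ i, Monotone (g' i)) ∨ (∀ i, Antitone (g' i)) := by
        rcases hm with hm | hm
        · left; intro i'
          by_cases h : i' = i
          · subst h; simp only [g', Function.update_self]
            intro x y hxy; exact hm i' (by omega)
          · simp only [g', Function.update_of_ne h]; exact hm i'
        · right; intro i'
          by_cases h : i' = i
          · subst h; simp only [g', Function.update_self]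
            intro x y hxy; exact hm i' (by omega)
          · simp only [g', Function.update_of_ne h]; exact hm i'
      have hgg : ∀ i x, 0 < g' i x := by
        intro i' x
        by_cases h : i' = i
        · subst h; simp only [g', Function.update_self]; exact hg _ _
        · simp only [g', Function.update_of_ne h]; exact hg _ _
      refine (ih hgg hmm).trans ?_
      rw [← Finset.mul_prod_erase _ _ (Finset.mem_univ i)]
      simp only [g', Function.update_self]
      apply le_of_eq
      congr 1
      apply Finset.prod_congr rfl
      intro l hl
      rw [Function.update_of_ne (Finset.ne_of_mem_erase hl)]
    set a : ι → ℝ := fun i => Bn (p i) t (g i) with ha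
    set b : ι → ℝ := fun i => Bn (p i) t (fun x => g i (x+1)) with hb
    have hapos : ∀ i, 0 < a i := fun i => Bn_pos (hp i) (hp1 i) t (hg i)
    have hbpos : ∀ i, 0 < b i := fun i => Bn_pos (hp i) (hp1 i) t (fun x => hg i (x+1))
    calc ∑ i, p i * ex p t (fun l => ∏ i', g i' ((i :: l).count i'))
        ≤ ∑ i, p i * (b i * ∏ l ∈ Finset.univ.erase i, a l) := by
          apply Finset.sum_le_sum
          intro i _
          exact mul_le_mul_of_nonneg_left (step i) (hp i)
      _ = ∏ i, a i - ∑ i, (p i * (a i - b i)) * ∏ l ∈ Finset.univ.erase i, a l := by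
          have : ∏ i, a i = ∑ i, p i * ∏ i, a i := by rw [← Finset.sum_mul, hs, one_mul]
          rw [this, ← Finset.sum_sub_distrib]
          apply Finset.sum_congr rfl
          intro i _
          rw [← Finset.mul_prod_erase _ a (Finset.mem_univ i)]; ring
      _ ≤ ∏ i, (a i - p i * (a i - b i)) := by
          apply prod_one_sub_ge _ _ _ hapos
          rcases hm with hm | hm
          · right; intro i
            have : a i ≤ b i := Bn_mono (hp i) (hp1 i) t (fun x => hm i (by omega))
            have := hp i
            nlinarith
          · left; intro i
            have h1 : b i ≤ a i := Bn_mono (hp i) (hp1 i) t (fun x => hm i (by omega))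
            have h2 := hp i
            have h3 := hp1 i
            have h4 := hbpos i
            constructor
            · apply mul_nonneg h2; linarith
            · nlinarith
      _ = ∏ i, Bn (p i) (t+1) (g i) := by
          apply Finset.prod_congr rfl
          intro i _
          simp only [Bn, ha, hb]; ring

end exlemmas

/-- The entries of column `j`, in order. -/
def colList {m n : ℕ} (j : Fin n) (l : List (Fin m × Fin n)) : List (Fin m) :=
  (l.filter (fun a => a.2 = j)).map Prod.fst

/-- Conditioning on the columns. -/
lemma ex_columns {m n : ℕ} (q : Fin n → ℝ) (P : Fin n → Fin m → ℝ) (k : ℕ) :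
    ∀ (φ : Fin n → List (Fin m) → ℝ),
    ex (fun a : Fin m × Fin n => q a.2 * P a.2 a.1) k (fun l => ∏ j, φ j (colList j l))
      = ex q k (fun l => ∏ j, ex (P j) (l.count j) (φ j)) := by
  induction k with
  | zero => intro φ; simp [ex, colList]
  | succ k ih =>
    intro φ
    simp only [ex]
    rw [Fintype.sum_prod_type_right]
    apply Finset.sum_congr rfl
    intro j _
    have h1 : ∀ i : Fin m, ex (fun a : Fin m × Fin n => q a.2 * P a.2 a.1) k
        (fun l => ∏ j', φ j' (colList j' ((i, j) :: l)))
        = ex q k (fun l => ex (P j) (l.count j) (fun l' => φ j (i :: l')) *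
            ∏ j' ∈ Finset.univ.erase j, ex (P j') (l.count j') (φ j')) := by
      intro i
      have := ih (Function.update φ j (fun l' => φ j (i :: l')))
      convert this using 2
      · funext l
        apply Finset.prod_congr rfl
        intro j' _
        by_cases h : j' = j
        · subst h; simp [colList]
        · have h' : ¬ j = j' := fun hh => h hh.symm
          simp [colList, h, h']
      · funext l
        rw [← Finset.mul_prod_erase _ _ (Finset.mem_univ j)]
        simp only [Function.update_self]
        congr 1
        apply Finset.prod_congr rfl
        intro j' hj'
        rw [Function.update_of_ne (Finset.ne_of_mem_erase hj')]
    simp only [h1]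
    have h2 : ∀ i : Fin m, q j * P j i * ex q k (fun l => ex (P j) (l.count j) (fun l' => φ j (i :: l')) *
            ∏ j' ∈ Finset.univ.erase j, ex (P j') (l.count j') (φ j'))
        = q j * ex q k (fun l => P j i * (ex (P j) (l.count j) (fun l' => φ j (i :: l')) *
            ∏ j' ∈ Finset.univ.erase j, ex (P j') (l.count j') (φ j'))) := by
      intro i; rw [ex_smul]; ring
    simp only [h2]
    rw [← Finset.mul_sum, ← ex_sum]
    congr 1
    apply ex_congr
    intro l _
    rw [← Finset.mul_prod_erase _ _ (Finset.mem_univ j)]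
    simp only [List.count_cons_self, ex]
    rw [Finset.sum_mul]
    apply Finset.sum_congr rfl
    intro i _
    rw [mul_assoc]
    congr 2
    apply Finset.prod_congr rfl
    intro j' hj'
    have h' : ¬ j = j' := fun hh => (Finset.ne_of_mem_erase hj') hh.symm
    simp [h']

/-! ### The block statistic -/

noncomputable def chi (a w : ℕ) (y : ℕ) : ℝ := if a ≤ y ∧ y < a + w then 1 / (w:ℝ) else 0

noncomputable def psi (a w : ℕ) (x : ℕ) : ℝ := ∑ y ∈ Finset.range x, chi a w y

noncomputable def Psi (a w : ℕ) (x : ℕ) : ℝ := ∑ y ∈ Finset.range x, psi a w y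

lemma chi_nonneg (a w y : ℕ) : 0 ≤ chi a w y := by
  unfold chi; split_ifs <;> positivity

lemma psi_nonneg (a w x : ℕ) : 0 ≤ psi a w x := Finset.sum_nonneg (fun _ _ => chi_nonneg _ _ _)

lemma psi_le_one (a w x : ℕ) : psi a w x ≤ 1 := by
  unfold psi chi
  rw [← Finset.sum_filter, Finset.sum_const, nsmul_eq_mul]
  have hc : (Finset.filter (fun y => a ≤ y ∧ y < a + w) (Finset.range x)).card ≤ w := by
    calc _ ≤ (Finset.Ico a (a+w)).card := by
          apply Finset.card_le_card
          intro y hy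
          simp at hy ⊢
          exact hy.2
      _ = w := by simp
  have hc' : ((Finset.filter (fun y => a ≤ y ∧ y < a + w) (Finset.range x)).card : ℝ) ≤ w := by
    exact_mod_cast hc
  rcases Nat.eq_zero_or_pos w with h | h
  · subst h; simp
  · have : (0:ℝ) < w := by exact_mod_cast h
    rw [mul_one_div, div_le_one this]; exact hc'

lemma psi_zero (a w : ℕ) : psi a w 0 = 0 := by simp [psi]
lemma psi_succ (a w x : ℕ) : psi a w (x+1) - psi a w x = chi a w x := by
  simp [psi, Finset.sum_range_succ]
lemma Psi_zero (a w : ℕ) : Psi a w 0 = 0 := by simp [Psi]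
lemma Psi_succ (a w x : ℕ) : Psi a w (x+1) - Psi a w x = psi a w x := by
  simp [Psi, Finset.sum_range_succ]
lemma Psi_nonneg (a w x : ℕ) : 0 ≤ Psi a w x := Finset.sum_nonneg (fun _ _ => psi_nonneg _ _ _)
lemma Psi_mono (a w : ℕ) : Monotone (Psi a w) := by
  apply monotone_nat_of_le_succ
  intro x
  have := Psi_succ a w x; have := psi_nonneg a w x; linarith
lemma Psi_lip (a w x : ℕ) : Psi a w (x+1) ≤ Psi a w x + 1 := by
  have := Psi_succ a w x; have := psi_le_one a w x; linarith
lemma Psi_le (a w x : ℕ) : Psi a w (x+1) ≤ x := by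
  induction x with
  | zero => have := Psi_succ a w 0; rw [psi_zero, Psi_zero] at this; simp; linarith
  | succ x ih => have := Psi_lip a w (x+1); push_cast; linarith
lemma Psi_le' (a w x : ℕ) : Psi a w x ≤ x := by
  cases x with
  | zero => simp [Psi_zero]
  | succ x => have := Psi_le a w x; push_cast; linarith
lemma Psi_sq (a w x : ℕ) : Psi a w x ^ 2 ≤ x * (x - 1) := by
  cases x with
  | zero => simp [Psi_zero]
  | succ x =>
    have := Psi_le a w x; have := Psi_nonneg a w (x+1); push_cast; nlinarith

lemma Bn_hasDerivAt (t : ℕ) : ∀ (f : ℕ → ℝ) (p : ℝ),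
    HasDerivAt (fun p => Bn p t f) (t * Bn p (t-1) (fun x => f (x+1) - f x)) p := by
  induction t with
  | zero => intro f p; simpa [Bn] using hasDerivAt_const p (f 0)
  | succ t ih =>
    intro f p
    simp only [Bn]
    have h1 := ((hasDerivAt_const p (1:ℝ)).sub (hasDerivAt_id p)).mul (ih f p)
    have h2 := (hasDerivAt_id p).mul (ih (fun x => f (x+1)) p)
    have h := h1.add h2
    refine HasDerivAt.congr_deriv h ?_
    simp only [Nat.add_sub_cancel, id, Pi.sub_apply]
    rw [Bn_sub p t (fun x => f (x+1)) f]
    cases t with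
    | zero => simp [Bn]; ring
    | succ s =>
      simp only [Nat.add_sub_cancel]
      have e : Bn p (s+1) (fun x => f (x+1)) - Bn p (s+1) f
          = (1-p) * Bn p s (fun x => f (x+1) - f x) + p * Bn p s (fun x => f (x+1+1) - f (x+1)) := by
        rw [← Bn_sub]; rfl
      have e2 : ((s + 1 + 1 : ℕ):ℝ) * (Bn p (s+1) (fun x => f (x+1)) - Bn p (s+1) f)
        = (Bn p (s+1) (fun x => f (x+1)) - Bn p (s+1) f) + (s+1:ℕ) *
         ((1-p) * Bn p s (fun x => f (x+1) - f x) + p * Bn p s (fun x => f (x+1+1) - f (x+1))) := by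
        rw [← e]; push_cast; ring
      rw [e2]; push_cast; ring

lemma tangent_le {G G1 G2 : ℝ → ℝ} (h1 : ∀ x, HasDerivAt G (G1 x) x)
    (h2 : ∀ x, HasDerivAt G1 (G2 x) x) {u p : ℝ}
    (hn : ∀ x, x ∈ Set.uIcc u p → 0 ≤ G2 x) : G u + G1 u * (p - u) ≤ G p := by
  have hmono : MonotoneOn G1 (Set.uIcc u p) := by
    apply monotoneOn_of_deriv_nonneg (convex_uIcc u p)
    · exact fun x _ => (h2 x).continuousAt.continuousWithinAt
    · exact fun x _ => (h2 x).differentiableAt.differentiableWithinAt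
    · intro x hx
      rw [(h2 x).deriv]
      exact hn x (interior_subset hx)
  rcases lt_trichotomy u p with h | h | h
  · obtain ⟨c, hc, he⟩ := exists_hasDerivAt_eq_slope G G1 h
      (fun x _ => (h1 x).continuousAt.continuousWithinAt) (fun x _ => h1 x)
    have hm := hmono (Set.left_mem_uIcc) (Set.mem_uIcc.mpr (Or.inl ⟨hc.1.le, hc.2.le⟩)) hc.1.le
    have hpos : 0 < p - u := by linarith
    rw [he, le_div_iff₀ hpos] at hm
    linarith
  · subst h; simp
  · obtain ⟨c, hc, he⟩ := exists_hasDerivAt_eq_slope G G1 h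
      (fun x _ => (h1 x).continuousAt.continuousWithinAt) (fun x _ => h1 x)
    have hm := hmono (Set.mem_uIcc.mpr (Or.inr ⟨hc.1.le, hc.2.le⟩)) (Set.left_mem_uIcc) hc.2.le
    have hpos : 0 < u - p := by linarith
    rw [he, div_le_iff₀ hpos] at hm
    linarith

lemma strong_near {G G1 G2 : ℝ → ℝ} (h1 : ∀ x, HasDerivAt G (G1 x) x)
    (h2 : ∀ x, HasDerivAt G1 (G2 x) x) {u p K : ℝ}
    (hn : ∀ x, x ∈ Set.uIcc u p → K ≤ G2 x) : G u + G1 u * (p - u) + K / 2 * (p-u)^2 ≤ G p := by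
  have := tangent_le (G := fun x => G x - K / 2 * (x-u)^2) (G1 := fun x => G1 x - K * (x - u))
    (G2 := fun x => G2 x - K) (u := u) (p := p) ?_ ?_ ?_
  · simp at this; linarith
  · intro x
    have := (h1 x).sub ((((hasDerivAt_id x).sub_const u).pow 2).const_mul (K/2))
    refine this.congr_deriv ?_
    simp; ring
  · intro x
    have := (h2 x).sub (((hasDerivAt_id x).sub_const u).const_mul K)
    refine this.congr_deriv ?_
    simp
  · intro x hx; have := hn x hx; simp; linarith

lemma strong_convex {G G1 G2 : ℝ → ℝ} (h1 : ∀ x, HasDerivAt G (G1 x) x)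
    (h2 : ∀ x, HasDerivAt G1 (G2 x) x) {u p K r : ℝ} (hr : 0 < r) (hK : 0 ≤ K)
    (hn0 : ∀ x, x ∈ Set.uIcc u p → 0 ≤ G2 x)
    (hn : ∀ x, x ∈ Set.uIcc u p → |x - u| ≤ r → K ≤ G2 x) :
    K / 2 * min ((p-u)^2) (r * |p-u|) ≤ G p - G u - G1 u * (p - u) := by
  by_cases hc : |p - u| ≤ r
  · have := strong_near h1 h2 (u := u) (p := p) (K := K) (fun x hx => hn x hx (by
      exact (Set.abs_sub_left_of_mem_uIcc hx).trans hc))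
    have hm : K / 2 * min ((p-u)^2) (r * |p-u|) ≤ K / 2 * (p-u)^2 := by
      gcongr; exact min_le_left _ _
    linarith
  · push Not at hc
    have hpu : 0 < |p - u| := hr.trans hc
    set ρ := r / |p-u| with hρ
    have hρ0 : 0 < ρ := by positivity
    have hρ1 : ρ < 1 := (div_lt_one hpu).mpr hc
    set y := u + ρ * (p - u) with hy
    have hyu : |y - u| = r := by
      rw [hy, add_sub_cancel_left, abs_mul, abs_of_pos hρ0, hρ]; field_simp
    have hymem : y ∈ Set.uIcc u p := by
      have : y ∈ segment ℝ u p := ⟨1 - ρ, ρ, by linarith, hρ0.le, by ring, by simp [hy]; ring⟩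
      rwa [segment_eq_uIcc] at this
    have hsub1 : Set.uIcc u y ⊆ Set.uIcc u p := Set.uIcc_subset_uIcc_left hymem
    have hsub2 : Set.uIcc y p ⊆ Set.uIcc u p := Set.uIcc_subset_uIcc_right hymem
    have a1 := strong_near h1 h2 (u := u) (p := y) (K := K) (fun x hx => hn x (hsub1 hx) (by
      exact (Set.abs_sub_left_of_mem_uIcc hx).trans hyu.le))
    have a2 := tangent_le h1 h2 (u := y) (p := p) (fun x hx => hn0 x (hsub2 hx))
    have a3 := tangent_le h1 h2 (u := y) (p := u) (fun x hx => hn0 x (hsub1 (by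
      rwa [Set.uIcc_comm] at hx)))
    have e1 : (y - u)^2 = r^2 := by rw [← sq_abs, hyu]
    rw [e1] at a1
    have hm : K / 2 * min ((p-u)^2) (r * |p-u|) ≤ K / 2 * (r * |p-u|) := by
      gcongr; exact min_le_right _ _
    -- combine
    have b : ρ * (G p - G u - G1 u * (p-u)) ≥ K / 2 * r^2 := by
      have c1 : ρ * (G y + G1 y * (p - y)) ≤ ρ * G p := mul_le_mul_of_nonneg_left a2 hρ0.le
      have c2 : (1-ρ) * (G y + G1 y * (u - y)) ≤ (1-ρ) * G u :=
        mul_le_mul_of_nonneg_left a3 (by linarith)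
      have e2 : ρ * (p - y) + (1 - ρ) * (u - y) = 0 := by rw [hy]; ring
      have e3 : y - u = ρ * (p - u) := by rw [hy]; ring
      rw [e3] at a1
      have e4 : ρ * (G y + G1 y * (p - y)) + (1-ρ) * (G y + G1 y * (u - y)) = G y := by
        linear_combination (G1 y) * e2
      nlinarith
    have hρr : ρ * |p - u| = r := by rw [hρ]; field_simp
    have : ρ * (K / 2 * (r * |p-u|)) = K / 2 * r^2 := by
      rw [← hρr]; ring
    have : ρ * (K / 2 * (r * |p-u|)) ≤ ρ * (G p - G u - G1 u * (p-u)) := by linarith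
    exact hm.trans (le_of_mul_le_mul_left this hρ0)

noncomputable def wd (t m : ℕ) : ℕ := ⌈8 * Real.sqrt (t / m)⌉₊ + 32
noncomputable def lo (t m : ℕ) : ℕ := ⌈((t:ℝ) / m)⌉₊ - wd t m / 2

lemma chi_ge (t m x : ℕ) : (1 / (wd t m : ℝ)) * (1 - ((x:ℝ) - t / m)^2 / (3 * wd t m / 8)^2)
    ≤ chi (lo t m) (wd t m) x := by
  have hw : (32:ℝ) ≤ wd t m := by unfold wd; push_cast; linarith [Nat.cast_nonneg (α := ℝ) ⌈8 * Real.sqrt ((t:ℝ) / m)⌉₊]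
  have hc0 : (0:ℝ) ≤ (t:ℝ)/m := by positivity
  have hceil := Nat.le_ceil ((t:ℝ)/m)
  have hceil2 := Nat.ceil_lt_add_one hc0
  set w := wd t m with hwd
  set c := (t:ℝ)/m with hcd
  have hlo1 : lo t m = ⌈c⌉₊ - w / 2 := rfl
  unfold chi
  split_ifs with h
  · have : 0 ≤ ((x:ℝ) - c)^2 / (3 * w / 8)^2 := by positivity
    have h2 : 0 < 1 / (w:ℝ) := by positivity
    nlinarith
  · have hs : (3 * (w:ℝ) / 8)^2 ≤ ((x:ℝ) - c)^2 := by
      rw [not_and_or] at h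
      have hdiv : ((w / 2 : ℕ):ℝ) ≤ w / 2 := Nat.cast_div_le
      have hdiv2 : (w:ℝ) / 2 - 1/2 ≤ ((w / 2 : ℕ):ℝ) := by
        have : w ≤ 2 * (w/2) + 1 := by omega
        have : (w:ℝ) ≤ 2 * ((w/2 : ℕ):ℝ) + 1 := by exact_mod_cast this
        linarith
      rcases h with h | h
      · push Not at h
        have h3 : x + 1 + w / 2 ≤ ⌈c⌉₊ := by omega
        have h4 : (x:ℝ) + 1 + ((w / 2 : ℕ):ℝ) ≤ ⌈c⌉₊ := by exact_mod_cast h3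
        have : (x:ℝ) - c ≤ -(3 * w / 8) := by linarith
        nlinarith
      · push Not at h
        have h3 : ⌈c⌉₊ + w ≤ x + w / 2 := by omega
        have h4 : (⌈c⌉₊:ℝ) + w ≤ x + ((w / 2 : ℕ):ℝ) := by exact_mod_cast h3
        have : 3 * w / 8 ≤ (x:ℝ) - c := by linarith
        nlinarith
    have hp : 0 < (3 * (w:ℝ) / 8)^2 := by positivity
    have : 1 ≤ ((x:ℝ) - c)^2 / (3 * w / 8)^2 := (one_le_div hp).mpr hs
    have h2 : 0 < 1 / (w:ℝ) := by positivity
    nlinarith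

lemma Bn_chi_ge {t m : ℕ} (ht : 2 ≤ t) {p : ℝ} (h0 : 0 ≤ p) (h1 : p ≤ 1)
    (hp : |p - 1 / m| ≤ wd t m / (16 * t)) :
    1 / (2 * (wd t m:ℝ)) ≤ Bn p (t-2) (chi (lo t m) (wd t m)) := by
  have hb := Bn_mono h0 h1 (t-2) (chi_ge t m)
  refine le_trans ?_ hb
  have hw : (32:ℝ) ≤ wd t m := by unfold wd; push_cast; linarith [Nat.cast_nonneg (α := ℝ) ⌈8 * Real.sqrt ((t:ℝ) / m)⌉₊]
  have hw2 : 8 * Real.sqrt ((t:ℝ)/m) ≤ wd t m := by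
    unfold wd; push_cast; linarith [Nat.le_ceil (8 * Real.sqrt ((t:ℝ) / m))]
  have hc0 : (0:ℝ) ≤ (t:ℝ)/m := by positivity
  have hsq := Real.sq_sqrt hc0
  have hsn := Real.sqrt_nonneg ((t:ℝ)/m)
  have ht0 : (0:ℝ) < t := by positivity
  have hA : |t * p - t / m| ≤ wd t m / 16 := by
    have e : t * p - t / m = t * (p - 1/m) := by ring
    rw [e, abs_mul, abs_of_pos ht0]
    calc (t:ℝ) * |p - 1/m| ≤ t * (wd t m / (16*t)) := by gcongr
      _ = wd t m / 16 := by field_simp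
  set w : ℝ := (wd t m : ℝ) with hwd
  set c := (t:ℝ)/m with hcd
  have hcw : c ≤ w^2 / 64 := by nlinarith
  rw [Bn_smul, Bn_sub, Bn_const]
  have e : (fun x : ℕ => ((x:ℝ) - c)^2 / (3 * w / 8)^2) = fun x : ℕ => (1/(3*w/8)^2) * ((x:ℝ) - c)^2 := by
    funext x; ring
  rw [e, Bn_smul, Bn_sq]
  have hcast : ((t - 2 : ℕ):ℝ) = t - 2 := by push_cast [ht]; ring
  rw [hcast]
  obtain ⟨hA1, hA2⟩ := abs_le.mp hA
  have ht2 : (2:ℝ) ≤ t := by exact_mod_cast ht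
  have hV : ((t:ℝ) - 2) * p * (1-p) ≤ w^2/64 + w^2/512 := by
    have : ((t:ℝ) - 2) * p * (1-p) ≤ t * p := by
      have : 0 ≤ ((t:ℝ)-2) * p := by apply mul_nonneg <;> linarith
      nlinarith
    nlinarith
  have hM : (((t:ℝ) - 2) * p - c)^2 ≤ w^2/64 := by
    have h3 : |((t:ℝ) - 2) * p - c| ≤ w/8 := by
      rw [abs_le]; constructor <;> nlinarith
    calc _ = |((t:ℝ) - 2) * p - c|^2 := (sq_abs _).symm
      _ ≤ (w/8)^2 := by gcongr
      _ = _ := by ring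
  have hs : 1 / (3*w/8)^2 * (((t:ℝ) - 2) * p * (1-p) + (((t:ℝ) - 2) * p - c)^2) ≤ 1/2 := by
    rw [one_div, inv_mul_le_iff₀ (by positivity)]
    nlinarith
  have h2 : 0 < 1 / w := by positivity
  calc 1 / (2*w) = 1/w * (1/2) := by field_simp
    _ ≤ _ := by gcongr; linarith

noncomputable def Gt (t m : ℕ) (p : ℝ) : ℝ := Bn p t (Psi (lo t m) (wd t m))
noncomputable def Gt1 (t m : ℕ) (p : ℝ) : ℝ := t * Bn p (t-1) (psi (lo t m) (wd t m))
noncomputable def Gt2 (t m : ℕ) (p : ℝ) : ℝ :=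
  t * ((t - 1 : ℕ) * Bn p (t-1-1) (chi (lo t m) (wd t m)))

lemma Gt_deriv (t m : ℕ) (p : ℝ) : HasDerivAt (Gt t m) (Gt1 t m p) p := by
  have := Bn_hasDerivAt t (Psi (lo t m) (wd t m)) p
  simp only [Psi_succ] at this
  exact this
lemma Gt1_deriv (t m : ℕ) (p : ℝ) : HasDerivAt (Gt1 t m) (Gt2 t m p) p := by
  have := (Bn_hasDerivAt (t-1) (psi (lo t m) (wd t m)) p).const_mul (t:ℝ)
  simp only [psi_succ] at this
  exact this

lemma mem_uIcc_unit {u p x : ℝ} (hu : 0 ≤ u ∧ u ≤ 1) (hp : 0 ≤ p ∧ p ≤ 1) (hx : x ∈ Set.uIcc u p) :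
    0 ≤ x ∧ x ≤ 1 := by
  rcases Set.mem_uIcc.mp hx with h | h <;> constructor <;> linarith [h.1, h.2]

/-- Excess of a cell. -/
noncomputable def exc (t m : ℕ) (p : ℝ) : ℝ :=
  Gt t m p - Gt t m (1/m) - Gt1 t m (1/m) * (p - 1/m)

lemma unit_inv {m : ℕ} (hm : 1 ≤ m) : (0:ℝ) ≤ 1/m ∧ (1:ℝ)/m ≤ 1 := by
  have : (1:ℝ) ≤ m := by exact_mod_cast hm
  exact ⟨by positivity, by rw [div_le_one (by linarith)]; exact this⟩

lemma exc_nonneg {t m : ℕ} (hm : 1 ≤ m) {p : ℝ} (hp : 0 ≤ p ∧ p ≤ 1) : 0 ≤ exc t m p := by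
  have := tangent_le (Gt_deriv t m) (Gt1_deriv t m) (u := 1/m) (p := p) (by
    intro x hx
    have := mem_uIcc_unit (unit_inv hm) hp hx
    unfold Gt2
    have := Bn_nonneg this.1 this.2 (t-1-1) (chi_nonneg (lo t m) (wd t m))
    positivity)
  unfold exc; linarith

lemma wd_ge (t m : ℕ) : (32:ℝ) ≤ wd t m := by
  unfold wd; push_cast; linarith [Nat.cast_nonneg (α := ℝ) ⌈8 * Real.sqrt ((t:ℝ) / m)⌉₊]

lemma exc_ge {t m : ℕ} (hm : 1 ≤ m) (ht : 2 ≤ t) {p : ℝ} (hp : 0 ≤ p ∧ p ≤ 1) :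
    min ((t * |p - 1/m|)^2 / (8 * wd t m)) (t * |p - 1/m| / 128) ≤ exc t m p := by
  have hw := wd_ge t m
  have ht2 : (2:ℝ) ≤ t := by exact_mod_cast ht
  have key := strong_convex (Gt_deriv t m) (Gt1_deriv t m) (u := 1/m) (p := p)
    (K := t^2 / (4 * wd t m)) (r := wd t m / (16 * t)) (by positivity) (by positivity)
    (by
      intro x hx
      have := mem_uIcc_unit (unit_inv hm) hp hx
      unfold Gt2
      have := Bn_nonneg this.1 this.2 (t-1-1) (chi_nonneg (lo t m) (wd t m))
      positivity)
    (by
      intro x hx hxr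
      have h01 := mem_uIcc_unit (unit_inv hm) hp hx
      have h := Bn_chi_ge ht h01.1 h01.2 hxr
      unfold Gt2
      have e : t - 1 - 1 = t - 2 := by omega
      rw [e]
      have hc : ((t - 1 : ℕ):ℝ) = t - 1 := by push_cast [show 1 ≤ t by omega]; ring
      rw [hc]
      calc (t:ℝ)^2 / (4 * wd t m) = t * ((t/2) * (1/(2 * wd t m))) := by field_simp; ring
        _ ≤ t * ((t - 1) * Bn x (t-2) (chi (lo t m) (wd t m))) := by
          gcongr <;> linarith)
  refine le_trans (le_of_eq ?_) key
  rw [← sq_abs (p - 1/m)]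
  set η := |p - 1/(m:ℝ)|
  rw [mul_min_of_nonneg _ _ (by positivity)]
  congr 1
  · field_simp; ring
  · field_simp; ring

/-- Block statistic. -/
noncomputable def blk (m : ℕ) (l : List (Fin m)) : ℝ :=
  ∑ i, Psi (lo l.length m) (wd l.length m) (l.count i) - m * Gt l.length m (1/m)

lemma ex_exp_blk {m : ℕ} {p : Fin m → ℝ} (hp : ∀ i, 0 ≤ p i) (hs : ∑ i, p i = 1) (t : ℕ) (lam : ℝ) :
    ex p t (fun l => Real.exp (lam * blk m l)) ≤
      Real.exp (-(lam * (m * Gt t m (1/m)))) *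
        ∏ i, Bn (p i) t (fun x => Real.exp (lam * Psi (lo t m) (wd t m) x)) := by
  have e : ex p t (fun l => Real.exp (lam * blk m l)) =
      Real.exp (-(lam * (m * Gt t m (1/m)))) *
      ex p t (fun l => ∏ i, Real.exp (lam * Psi (lo t m) (wd t m) (l.count i))) := by
    rw [← ex_smul]
    apply ex_congr
    intro l hl
    rw [← Real.exp_sum, ← Real.exp_add]
    congr 1
    unfold blk
    rw [hl, ← Finset.mul_sum]
    ring
  rw [e]
  gcongr
  apply ex_na hp hs t (g := fun _ x => Real.exp (lam * Psi (lo t m) (wd t m) x))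
  · intro i x; positivity
  · rcases le_total 0 lam with h | h
    · left
      intro i a b hab
      apply Real.exp_le_exp.mpr
      exact mul_le_mul_of_nonneg_left (Psi_mono _ _ hab) h
    · right
      intro i a b hab
      apply Real.exp_le_exp.mpr
      exact mul_le_mul_of_nonpos_left (Psi_mono _ _ hab) h

lemma Psi_step (a w x : ℕ) : Psi a w x ≤ Psi a w (x+1) := Psi_mono a w (Nat.le_succ x)

lemma null_block {m : ℕ} (hm : 1 ≤ m) {lam : ℝ} (h0 : 0 ≤ lam) (h1 : lam ≤ 1) (t : ℕ) :
    ex (fun _ : Fin m => (1:ℝ)/m) t (fun l => Real.exp (lam * blk m l)) ≤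
      Real.exp (81 * lam^2 * (t * min 1 ((t:ℝ)/m))) := by
  have hm' : (1:ℝ) ≤ m := by exact_mod_cast hm
  have hu := unit_inv hm
  have hcell : Bn (1/(m:ℝ)) t (fun x => Real.exp (lam * Psi (lo t m) (wd t m) x)) ≤
      Real.exp (lam * Gt t m (1/m) + 81 * lam^2 * (t * min 1 ((t:ℝ)/m)) / m) := by
    rcases le_total ((t:ℝ)/m) 1 with h | h
    · have := Bn_exp_pos hu.1 hu.2 h0 h1 t (by rw [mul_one_div]; exact h)
        (Psi_nonneg (lo t m) (wd t m)) (Psi_le' _ _) (Psi_sq _ _)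
      refine this.trans (Real.exp_le_exp.mpr ?_)
      rw [min_eq_right h]
      unfold Gt
      apply le_of_eq
      field_simp
    · have := Bn_exp_lip hu.1 hu.2 (lam := lam) (by rw [abs_of_nonneg h0]; exact h1) t
        (Psi_step (lo t m) (wd t m)) (Psi_lip _ _)
      refine this.trans (Real.exp_le_exp.mpr ?_)
      rw [min_eq_left h]
      unfold Gt
      have e : 81 * lam^2 * ((t:ℝ) * 1) / m = 81 * (lam^2 * (t * (1/m))) := by field_simp
      rw [e]
      have : 0 ≤ lam^2 * ((t:ℝ) * (1/m)) := by positivity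
      linarith
  have hB := ex_exp_blk (p := fun _ : Fin m => (1:ℝ)/m) (fun _ => hu.1)
    (by simp; field_simp) t lam
  refine hB.trans ?_
  calc _ ≤ Real.exp (-(lam * (m * Gt t m (1/m)))) *
        ∏ i : Fin m, Real.exp (lam * Gt t m (1/m) + 81 * lam^2 * (t * min 1 ((t:ℝ)/m)) / m) := by
        gcongr with i _
        · exact fun i _ => Bn_nonneg hu.1 hu.2 t (fun x => by positivity)
    _ = _ := by
      rw [← Real.exp_sum, ← Real.exp_add]
      congr 1
      simp
      field_simp
      ring

noncomputable def gap (t m : ℕ) (p : Fin m → ℝ) : ℝ := ∑ i, Gt t m (p i) - m * Gt t m (1/m)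

lemma gap_eq {t m : ℕ} (hm : 1 ≤ m) {p : Fin m → ℝ} (hs : ∑ i, p i = 1) :
    gap t m p = ∑ i, exc t m (p i) := by
  have hm' : (1:ℝ) ≤ m := by exact_mod_cast hm
  unfold gap exc
  rw [Finset.sum_sub_distrib, Finset.sum_sub_distrib, ← Finset.mul_sum, Finset.sum_sub_distrib, hs]
  have : (m:ℝ) * (m:ℝ)⁻¹ = 1 := mul_inv_cancel₀ (by positivity)
  simp [this]

lemma Bn_small {t : ℕ} (ht : t ≤ 1) (p : ℝ) {f : ℕ → ℝ} (h0 : f 0 = 0) (h1 : f 1 = 0) :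
    Bn p t f = 0 := by
  interval_cases t <;> simp [Bn, h0, h1]

lemma Psi_small (a w : ℕ) {x : ℕ} (hx : x ≤ 1) : Psi a w x = 0 := by
  interval_cases x
  · simp [Psi]
  · simp [Psi, psi]

lemma Gt_small {t : ℕ} (ht : t ≤ 1) (m : ℕ) (p : ℝ) : Gt t m p = 0 :=
  Bn_small ht p (Psi_small _ _ (by norm_num)) (Psi_small _ _ (by norm_num))

lemma gap_small {t : ℕ} (ht : t ≤ 1) (m : ℕ) (p : Fin m → ℝ) : gap t m p = 0 := by
  simp [gap, Gt_small ht]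

lemma blk_small {m : ℕ} {l : List (Fin m)} (h : l.length ≤ 1) : blk m l = 0 := by
  unfold blk
  rw [Gt_small h]
  have : ∀ i, Psi (lo l.length m) (wd l.length m) (l.count i) = 0 :=
    fun i => Psi_small _ _ (le_trans List.count_le_length h)
  simp [this]

/-- Cost of one cell. -/
lemma alt_cell {t m : ℕ} {p lam : ℝ} (hp : 0 ≤ p ∧ p ≤ 1) (h0 : 0 ≤ lam) (h1 : lam ≤ 1) :
    Bn p t (fun x => Real.exp (-lam * Psi (lo t m) (wd t m) x)) ≤
      Real.exp (-lam * Gt t m p + lam^2 * min (t * p) ((t*p)^2)) := by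
  rcases le_total ((t:ℝ)*p) ((t*p)^2) with h | h
  · rw [min_eq_left h]
    have := Bn_exp_lip hp.1 hp.2 (lam := -lam) (by rw [abs_neg, abs_of_nonneg h0]; exact h1) t
        (Psi_step (lo t m) (wd t m)) (Psi_lip _ _)
    rw [neg_sq] at this
    exact this
  · rw [min_eq_right h]
    exact Bn_exp_neg hp.1 hp.2 h0 t (Psi_nonneg (lo t m) (wd t m)) (Psi_sq _ _)

lemma wd_le (t m : ℕ) : (wd t m : ℝ) ≤ 8 * Real.sqrt (t/m) + 33 := by
  unfold wd
  push_cast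
  have := Nat.ceil_lt_add_one (a := 8 * Real.sqrt ((t:ℝ)/m)) (by positivity)
  linarith

lemma cost_cell {t m : ℕ} (hm : 1 ≤ m) (ht : 2 ≤ t) (htm : (t:ℝ)/m ≤ 1) {p : ℝ} (hp : 0 ≤ p ∧ p ≤ 1) :
    min (t * p) ((t*p)^2) ≤ 2 * ((t:ℝ)/m)^2 + 656 * exc t m p := by
  have hw : (wd t m : ℝ) ≤ 41 := by
    have := wd_le t m
    have h1 : Real.sqrt ((t:ℝ)/m) ≤ 1 := by rw [Real.sqrt_le_iff]; exact ⟨by norm_num, by linarith⟩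
    linarith
  have hw0 := wd_ge t m
  have he := exc_ge hm ht hp
  set y := (t:ℝ) * |p - 1/m| with hy
  have hy0 : 0 ≤ y := by positivity
  have hyy : y^2 = (t * p - t/m)^2 := by
    rw [hy, mul_pow, sq_abs]; ring
  have hy1 : t * p ≤ t/m + y := by
    have : (t:ℝ) * p - t/m = t * (p - 1/m) := by ring
    have h2 : (t:ℝ) * (p - 1/m) ≤ y := by
      rw [hy]; gcongr; exact le_abs_self _
    linarith
  have hu : (0:ℝ) ≤ t/m := by positivity
  have hex : min y (y^2) ≤ 328 * exc t m p := by
    rcases le_total (y ^ 2 / (8 * wd t m)) (y/128) with h | h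
    · rw [min_eq_left h] at he
      have : y^2 / 328 ≤ y^2 / (8 * wd t m) := by gcongr; linarith
      linarith [min_le_right y (y^2)]
    · rw [min_eq_right h] at he
      linarith [min_le_left y (y^2)]
  have hmain : min (t * p) ((t*p)^2) ≤ 2 * ((t:ℝ)/m)^2 + 2 * min y (y^2) := by
    rcases le_total y 1 with h | h
    · have : min y (y^2) = y^2 := min_eq_right (by nlinarith)
      rw [this]
      refine (min_le_right _ _).trans ?_
      have : 0 ≤ (t:ℝ) * p := mul_nonneg (by positivity) hp.1
      nlinarith [sq_nonneg ((t:ℝ)/m - y)]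
    · have : min y (y^2) = y := min_eq_left (by nlinarith)
      rw [this]
      refine (min_le_left _ _).trans ?_
      nlinarith [sq_nonneg ((t:ℝ)/m)]
  linarith

lemma alt_block {m : ℕ} (hm : 1 ≤ m) {lam : ℝ} (h0 : 0 ≤ lam) (h1 : lam ≤ 1/1312) (t : ℕ)
    {p : Fin m → ℝ} (hp : ∀ i, 0 ≤ p i) (hs : ∑ i, p i = 1) :
    ex p t (fun l => Real.exp (-lam * blk m l)) ≤
      Real.exp (-(lam/2) * gap t m p + 81 * lam^2 * (t * min 1 ((t:ℝ)/m))) := by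
  have hm' : (1:ℝ) ≤ m := by exact_mod_cast hm
  have hp1 : ∀ i, p i ≤ 1 := fun i => by
    rw [← hs]; exact Finset.single_le_sum (fun j _ => hp j) (Finset.mem_univ i)
  rcases Nat.lt_or_ge 1 t with ht | ht
  swap
  · have e : ex p t (fun l => Real.exp (-lam * blk m l)) = ex p t (fun _ => 1) := by
      apply ex_congr
      intro l hl
      rw [blk_small (by omega)]; simp
    rw [e, ex_const hs, gap_small ht]
    apply Real.one_le_exp
    have : 0 ≤ min 1 ((t:ℝ)/m) := le_min (by norm_num) (by positivity)
    simp only [mul_zero, zero_add]; positivity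
  have hg0 : 0 ≤ gap t m p := by
    rw [gap_eq hm hs]; exact Finset.sum_nonneg (fun i _ => exc_nonneg hm ⟨hp i, hp1 i⟩)
  have hcost : lam^2 * ∑ i, min (t * p i) ((t * p i)^2) ≤
      (lam/2) * gap t m p + 81 * lam^2 * (t * min 1 ((t:ℝ)/m)) := by
    rcases le_total ((t:ℝ)/m) 1 with h | h
    · rw [min_eq_right h]
      have : ∑ i, min (t * p i) ((t * p i)^2) ≤ ∑ i : Fin m, (2 * ((t:ℝ)/m)^2 + 656 * exc t m (p i)) :=
        Finset.sum_le_sum (fun i _ => cost_cell hm ht h ⟨hp i, hp1 i⟩)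
      rw [Finset.sum_add_distrib, ← Finset.mul_sum (f := fun i => exc t m (p i)), ← gap_eq hm hs] at this
      simp only [Finset.sum_const, Finset.card_univ, Fintype.card_fin, nsmul_eq_mul] at this
      have e : (m:ℝ) * (2 * ((t:ℝ)/m)^2) = 2 * (t * (t/m)) := by field_simp
      rw [e] at this
      have hz : 0 ≤ (t:ℝ) * (t/m) := by positivity
      have h2 : lam^2 * 656 ≤ lam/2 := by nlinarith
      calc _ ≤ lam^2 * (2 * (t * (t/m)) + 656 * gap t m p) := by gcongr
        _ = (lam^2 * 656) * gap t m p + 2 * (lam^2 * (t * (t/m))) := by ring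
        _ ≤ (lam/2) * gap t m p + 81 * (lam^2 * (t * (t/m))) := by
          gcongr; norm_num
        _ = _ := by ring
    · rw [min_eq_left h]
      have : ∑ i, min (t * p i) ((t * p i)^2) ≤ ∑ i : Fin m, (t:ℝ) * p i :=
        Finset.sum_le_sum (fun i _ => min_le_left _ _)
      rw [← Finset.mul_sum, hs] at this
      have h3 : lam^2 * ∑ i, min (t * p i) ((t * p i)^2) ≤ lam^2 * (t * 1) := by gcongr
      have h4 : 0 ≤ lam^2 * ((t:ℝ) * 1) := by positivity
      have h5 : 0 ≤ lam/2 * gap t m p := by positivity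
      linarith
  refine (ex_exp_blk hp hs t (-lam)).trans ?_
  calc _ ≤ Real.exp (-(-lam * (m * Gt t m (1/m)))) *
        ∏ i : Fin m, Real.exp (-lam * Gt t m (p i) + lam^2 * min (t * p i) ((t*p i)^2)) := by
        gcongr with i _
        · exact fun i _ => Bn_nonneg (hp i) (hp1 i) t (fun x => by positivity)
        · exact alt_cell ⟨hp i, hp1 i⟩ h0 (by linarith)
    _ ≤ _ := by
      rw [← Real.exp_sum, ← Real.exp_add]
      apply Real.exp_le_exp.mpr
      rw [Finset.sum_add_distrib, ← Finset.mul_sum, ← Finset.mul_sum]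
      have : gap t m p = ∑ i, Gt t m (p i) - m * Gt t m (1/m) := rfl
      have e2 : -(-lam * (m * Gt t m (1/m))) + -lam * ∑ i, Gt t m (p i) = - (lam * gap t m p) := by
        rw [this]; ring
      linarith

/-- Rate function. -/
noncomputable def rate (e : ℝ) (m t : ℕ) : ℝ := e^2 / (m/t + Real.sqrt (m/t) + e)

lemma gap_ge {m : ℕ} (hm : 1 ≤ m) {t : ℕ} (ht : 2 ≤ t) {p : Fin m → ℝ} (hp : ∀ i, 0 ≤ p i)
    (hs : ∑ i, p i = 1) {e : ℝ} (he : e = (1/2) * ∑ i, |p i - 1/m|) :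
    (1/66) * (t * rate e m t) ≤ gap t m p := by
  have hm' : (1:ℝ) ≤ m := by exact_mod_cast hm
  have ht' : (2:ℝ) ≤ t := by exact_mod_cast ht
  have hp1 : ∀ i, p i ≤ 1 := fun i => by
    rw [← hs]; exact Finset.single_le_sum (fun j _ => hp j) (Finset.mem_univ i)
  have he0 : 0 ≤ e := by rw [he]; positivity
  have hw0 := wd_ge t m
  have hw1 := wd_le t m
  set w : ℝ := (wd t m : ℝ) with hw
  have hcell : ∀ i, (t * |p i - 1/m|)^2 / (8 * w + 128 * (t * |p i - 1/m|)) ≤ exc t m (p i) := by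
    intro i
    refine le_trans ?_ (exc_ge hm ht ⟨hp i, hp1 i⟩)
    have hy : 0 ≤ (t:ℝ) * |p i - 1/m| := by positivity
    set y := (t:ℝ) * |p i - 1/m|
    apply le_min
    · gcongr; linarith
    · rw [div_le_div_iff₀ (by positivity) (by norm_num)]
      nlinarith [mul_nonneg hy (by linarith : 0 ≤ w)]
  have hCS := Finset.sq_sum_div_le_sum_sq_div (Finset.univ : Finset (Fin m))
    (fun i => (t:ℝ) * |p i - 1/m|) (g := fun i => 8 * w + 128 * (t * |p i - 1/m|))
    (fun i _ => by positivity)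
  have hsum : ∑ i : Fin m, (t:ℝ) * |p i - 1/m| = 2 * t * e := by
    rw [← Finset.mul_sum, he]; ring
  have hsum2 : ∑ i : Fin m, (8 * w + 128 * ((t:ℝ) * |p i - 1/m|)) = 8 * w * m + 256 * (t * e) := by
    rw [Finset.sum_add_distrib, ← Finset.mul_sum (f := fun i => (t:ℝ) * |p i - 1/m|), hsum]; simp; ring
  rw [hsum, hsum2] at hCS
  rw [gap_eq hm hs]
  refine le_trans ?_ (hCS.trans (Finset.sum_le_sum (fun i _ => hcell i)))
  -- w m ≤ 8 sqrt(t m) + 33 m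
  have hsq : Real.sqrt ((t:ℝ)/m) * m = t * Real.sqrt (m/t) := by
    rw [Real.sqrt_div' _ (by positivity), Real.sqrt_div' _ (by positivity)]
    have a1 := Real.mul_self_sqrt (by positivity : (0:ℝ) ≤ m)
    have a2 := Real.mul_self_sqrt (by positivity : (0:ℝ) ≤ t)
    have : 0 < Real.sqrt m := Real.sqrt_pos.mpr (by positivity)
    have : 0 < Real.sqrt t := Real.sqrt_pos.mpr (by positivity)
    field_simp
    nlinarith
  have hs0 : 0 ≤ Real.sqrt ((m:ℝ)/t) := Real.sqrt_nonneg _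
  set s := Real.sqrt ((m:ℝ)/t)
  have hwm : w * m ≤ 8 * (t * s) + 33 * m := by
    calc w * m ≤ (8 * Real.sqrt ((t:ℝ)/m) + 33) * m := by gcongr
      _ = _ := by rw [← hsq]; ring
  have hden : 8 * w * m + 256 * (t * e) ≤ 264 * (t * (m/t + s + e)) := by
    have : (t:ℝ) * (m/t + s + e) = m + t * s + t * e := by field_simp
    rw [this]
    have : 0 ≤ t * s := by positivity
    have : 0 ≤ t * e := by positivity
    linarith
  unfold rate
  calc (1:ℝ)/66 * (t * (e^2 / (m/t + s + e))) = (2 * t * e)^2 / (264 * (t * (m/t + s + e))) := by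
        field_simp; ring
    _ ≤ _ := by
      apply div_le_div_of_nonneg_left (by positivity) _ hden
      have : 0 < 8 * w * m := by positivity
      have : 0 ≤ 256 * (t * e) := by positivity
      linarith

lemma rate_nonneg {e : ℝ} (he : 0 ≤ e) (m t : ℕ) : 0 ≤ rate e m t := by
  unfold rate; positivity

lemma rate_le {e : ℝ} (he : 0 ≤ e) (m t : ℕ) : rate e m t ≤ e := by
  unfold rate
  rcases he.eq_or_lt with h | h
  · subst h; simp
  · rw [div_le_iff₀ (by positivity)]
    have : 0 ≤ (m:ℝ)/t := by positivity
    have : 0 ≤ Real.sqrt ((m:ℝ)/t) := Real.sqrt_nonneg _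
    nlinarith [mul_nonneg he (by assumption), mul_nonneg he (by positivity : 0 ≤ (m:ℝ)/t)]

lemma rate_mono {e : ℝ} (he : 0 ≤ e) {m s t : ℕ} (hm : 1 ≤ m) (hs : 1 ≤ s) (hst : s ≤ t) :
    rate e m s ≤ rate e m t := by
  unfold rate
  have hm' : (1:ℝ) ≤ m := by exact_mod_cast hm
  have hs' : (1:ℝ) ≤ s := by exact_mod_cast hs
  have hst' : (s:ℝ) ≤ t := by exact_mod_cast hst
  have h : (m:ℝ)/t ≤ m/s := by gcongr
  have ht : (0:ℝ) < t := by linarith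
  apply div_le_div_of_nonneg_left (by positivity)
  · positivity
  · gcongr

/-- Column statistic: cut the column into blocks of size `g`. -/
noncomputable def cs (g m : ℕ) : ℕ → List (Fin m) → ℝ
  | 0, _ => 0
  | N + 1, l => if l.length ≤ g then blk m l else blk m (l.take g) + cs g m N (l.drop g)

lemma gap_nonneg {t m : ℕ} (hm : 1 ≤ m) {p : Fin m → ℝ} (hp : ∀ i, 0 ≤ p i) (hs : ∑ i, p i = 1) :
    0 ≤ gap t m p := by
  have hp1 : ∀ i, p i ≤ 1 := fun i => by
    rw [← hs]; exact Finset.single_le_sum (fun j _ => hp j) (Finset.mem_univ i)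
  rw [gap_eq hm hs]; exact Finset.sum_nonneg (fun i _ => exc_nonneg hm ⟨hp i, hp1 i⟩)

lemma ex_nonneg' {ι : Type*} [Fintype ι] {p : ι → ℝ} (hp : ∀ i, 0 ≤ p i) (hs : ∑ i, p i = 1) (t : ℕ)
    {f : List ι → ℝ} (hf : ∀ l, 0 ≤ f l) : 0 ≤ ex p t f := by
  have := ex_mono hp t (f := fun _ => 0) (g := f) (fun l _ => hf l)
  rwa [ex_const hs] at this

lemma cs_split {m g N T : ℕ} (p : Fin m → ℝ) (hT : g < T) (lam : ℝ) :
    ex p T (fun l => Real.exp (lam * cs g m (N+1) l)) =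
      ex p g (fun l => Real.exp (lam * blk m l)) *
      ex p (T - g) (fun l => Real.exp (lam * cs g m N l)) := by
  rw [← ex_append]
  have e : g + (T - g) = T := by omega
  rw [e]
  apply ex_congr
  intro l hl
  simp only [cs]
  rw [if_neg (by omega), mul_add, Real.exp_add]

lemma cs_nosplit {m g N T : ℕ} (p : Fin m → ℝ) (hT : T ≤ g) (lam : ℝ) :
    ex p T (fun l => Real.exp (lam * cs g m (N+1) l)) =
      ex p T (fun l => Real.exp (lam * blk m l)) := by
  apply ex_congr
  intro l hl
  simp only [cs]
  rw [if_pos (by omega)]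

lemma vmono {m g T : ℕ} (hT : T ≤ g) : (T:ℝ) * min 1 ((T:ℝ)/m) ≤ min 1 ((g:ℝ)/m) * T := by
  rw [mul_comm]
  have : (T:ℝ) ≤ g := by exact_mod_cast hT
  gcongr

lemma null_col {m g : ℕ} (hm : 1 ≤ m) (hg : 1 ≤ g) {lam : ℝ} (h0 : 0 ≤ lam) (h1 : lam ≤ 1) (N : ℕ) :
    ∀ T : ℕ, T ≤ N →
    ex (fun _ : Fin m => (1:ℝ)/m) T (fun l => Real.exp (lam * cs g m N l)) ≤
      Real.exp (81 * lam^2 * (min 1 ((g:ℝ)/m) * T)) := by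
  have hm' : (1:ℝ) ≤ m := by exact_mod_cast hm
  induction N with
  | zero =>
    intro T hT
    obtain rfl : T = 0 := by omega
    simp [ex, cs]
  | succ N ih =>
    intro T hT
    rcases Nat.lt_or_ge g T with h | h
    · rw [cs_split _ h]
      have a := null_block hm h0 h1 g
      have b := ih (T - g) (by omega)
      have c : 0 ≤ ex (fun _ : Fin m => (1:ℝ)/m) (T-g) (fun l => Real.exp (lam * cs g m N l)) :=
        ex_nonneg' (fun _ => by positivity) (by simp; field_simp) _ (fun l => by positivity)
      refine (mul_le_mul a b c (by positivity)).trans ?_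
      rw [← Real.exp_add]
      apply Real.exp_le_exp.mpr
      rw [Nat.cast_sub h.le]
      apply le_of_eq; ring
    · rw [cs_nosplit _ h]
      refine (null_block hm h0 h1 T).trans (Real.exp_le_exp.mpr ?_)
      have := vmono (m := m) h
      gcongr

lemma alt_col {m g : ℕ} (hm : 1 ≤ m) {lam : ℝ} (h0 : 0 ≤ lam) (h1 : lam ≤ 1/1312)
    {p : Fin m → ℝ} (hp : ∀ i, 0 ≤ p i) (hs : ∑ i, p i = 1) {e : ℝ}
    (he : e = (1/2) * ∑ i, |p i - 1/m|) {s : ℕ} (hs2 : 2 ≤ s) (hsg : s ≤ g) (N : ℕ) :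
    ∀ T : ℕ, T ≤ N →
    ex p T (fun l => Real.exp (-lam * cs g m N l)) ≤
      Real.exp (81 * lam^2 * (min 1 ((g:ℝ)/m) * T) - lam/132 * rate e m s * ((T + 1 - s : ℕ):ℝ)) := by
  have he0 : 0 ≤ e := by rw [he]; positivity
  have hr := rate_nonneg he0 m s
  have key : ∀ T : ℕ, s ≤ T → 1/66 * (T * rate e m s) ≤ gap T m p := fun T hT => by
    refine le_trans ?_ (gap_ge hm (by omega) hp hs he)
    have := rate_mono he0 hm (by omega) hT
    gcongr
  induction N with
  | zero =>
    intro T hT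
    obtain rfl : T = 0 := by omega
    have : 0 + 1 - s = 0 := by omega
    simp [ex, cs, this]
  | succ N ih =>
    intro T hT
    rcases Nat.lt_or_ge g T with h | h
    · rw [cs_split _ h]
      have a := alt_block hm h0 h1 g hp hs
      have b := ih (T - g) (by omega)
      have c : 0 ≤ ex p (T-g) (fun l => Real.exp (-lam * cs g m N l)) :=
        ex_nonneg' hp hs _ (fun l => by positivity)
      refine (mul_le_mul a b c (by positivity)).trans ?_
      rw [← Real.exp_add]
      apply Real.exp_le_exp.mpr
      rw [Nat.cast_sub h.le]
      have k := key g hsg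
      have hc : ((T + 1 - s : ℕ):ℝ) ≤ g + ((T - g + 1 - s : ℕ):ℝ) := by
        exact_mod_cast (by omega : T + 1 - s ≤ g + (T - g + 1 - s))
      have k2 : lam/2 * (1/66 * (g * rate e m s)) ≤ lam/2 * gap g m p := by gcongr
      have k3 : lam/132 * rate e m s * ((T + 1 - s : ℕ):ℝ) ≤
        lam/132 * rate e m s * (g + ((T - g + 1 - s : ℕ):ℝ)) := by gcongr
      have e1 : 81 * lam^2 * ((g:ℝ) * min 1 ((g:ℝ)/m)) + 81 * lam^2 * (min 1 ((g:ℝ)/m) * (T - g)) =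
        81 * lam^2 * (min 1 ((g:ℝ)/m) * T) := by ring
      linarith
    · rw [cs_nosplit _ h]
      refine (alt_block hm h0 h1 T hp hs).trans (Real.exp_le_exp.mpr ?_)
      have hv := vmono (m := m) h
      have hv2 : 81 * lam^2 * ((T:ℝ) * min 1 ((T:ℝ)/m)) ≤ 81 * lam^2 * (min 1 ((g:ℝ)/m) * T) := by gcongr
      rcases Nat.lt_or_ge T s with h3 | h3
      · have : T + 1 - s = 0 := by omega
        rw [this]
        have := gap_nonneg (t := T) hm hp hs
        have : 0 ≤ lam/2 * gap T m p := by positivity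
        simp; linarith
      · have k := key T h3
        have hc : ((T + 1 - s : ℕ):ℝ) ≤ T := by
          exact_mod_cast (by omega : T + 1 - s ≤ T)
        have k2 : lam/2 * (1/66 * (T * rate e m s)) ≤ lam/2 * gap T m p := by gcongr
        have k3 : lam/132 * rate e m s * ((T + 1 - s : ℕ):ℝ) ≤
          lam/132 * rate e m s * T := by gcongr
        linarith

/-- Block size at which the rate is evaluated. -/
noncomputable def sj (g : ℕ) (x : ℝ) : ℕ := if 4 ≤ x then min ⌊x/2⌋₊ g else 2

lemma sj_ge {g : ℕ} (hg : 2 ≤ g) (x : ℝ) : 2 ≤ sj g x := by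
  unfold sj
  split_ifs with h
  · apply le_min _ hg
    apply Nat.le_floor
    push_cast; linarith
  · exact le_rfl

lemma sj_le {g : ℕ} (hg : 2 ≤ g) (x : ℝ) : sj g x ≤ g := by
  unfold sj
  split_ifs with h
  · exact min_le_right _ _
  · exact hg

lemma Bn_ind0 (q : ℝ) (t : ℕ) : Bn q t (fun x => if x = 0 then (1:ℝ) else 0) = (1-q)^t := by
  induction t with
  | zero => simp [Bn]
  | succ t ih =>
    simp only [Bn, ih]
    have : Bn q t (fun x => if x + 1 = 0 then (1:ℝ) else 0) = 0 := by
      have := Bn_const q 0 t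
      simpa using this
    rw [this]; ring

lemma Bn_ind1 (q : ℝ) (t : ℕ) :
    Bn q (t+1) (fun x => if x ≤ 1 then (1:ℝ) else 0) = (1-q)^t * (1 + t*q) := by
  have e : (fun x : ℕ => if x + 1 ≤ 1 then (1:ℝ) else 0) = (fun x => if x = 0 then (1:ℝ) else 0) := by
    funext x
    have : x + 1 ≤ 1 ↔ x = 0 := by omega
    simp [this]
  induction t with
  | zero => simp [Bn]
  | succ t ih =>
    rw [Bn, ih, e, Bn_ind0]
    push_cast
    ring

lemma exp_neg_le34 {θ : ℝ} (h0 : 0 ≤ θ) (h1 : θ ≤ 1/4) : Real.exp (-θ) ≤ 1 - 3/4 * θ := by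
  have := exp_quad (y := -θ) (by rw [abs_neg, abs_of_nonneg h0]; linarith)
  nlinarith

lemma Bn_tail {q θ : ℝ} (hq0 : 0 ≤ q) (hq1 : q ≤ 1) (h0 : 0 ≤ θ) (h1 : θ ≤ 1/4) {k g : ℕ}
    (hk : 2 ≤ k) (hg : 2 ≤ g) :
    Bn q k (fun T => Real.exp (-θ * ((T + 1 - sj g (k*q) : ℕ):ℝ))) ≤
      Real.exp (-θ * ((k*q) * min 1 (k*q)) / 208) := by
  have hx0 : 0 ≤ (k:ℝ) * q := by positivity
  have h34 := exp_neg_le34 h0 h1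
  set x := (k:ℝ) * q with hx
  rcases le_or_gt 4 x with h4 | h4
  · have hs : (sj g x : ℝ) ≤ x/2 := by
      have : sj g x ≤ ⌊x/2⌋₊ := by unfold sj; rw [if_pos h4]; exact min_le_left _ _
      calc (sj g x : ℝ) ≤ ⌊x/2⌋₊ := by exact_mod_cast this
        _ ≤ x/2 := Nat.floor_le (by linarith)
    have hb : Bn q k (fun T => Real.exp (-θ * ((T + 1 - sj g x : ℕ):ℝ))) ≤
        Bn q k (fun T => Real.exp (θ * x/2) * (Real.exp (-θ))^T) := by
      apply Bn_mono hq0 hq1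
      intro T
      rw [← Real.exp_nat_mul, ← Real.exp_add]
      apply Real.exp_le_exp.mpr
      have : (T:ℝ) + 1 ≤ ((T + 1 - sj g x : ℕ):ℝ) + sj g x := by
        exact_mod_cast (by omega : T + 1 ≤ T + 1 - sj g x + sj g x)
      have h3 : (T:ℝ) - x/2 ≤ ((T + 1 - sj g x : ℕ):ℝ) := by linarith
      nlinarith
    rw [Bn_smul, Bn_geom] at hb
    refine hb.trans ?_
    have h5 : 1 - q + q * Real.exp (-θ) ≤ Real.exp (-(q * (3/4*θ))) := by
      have := Real.add_one_le_exp (-(q * (3/4*θ)))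
      nlinarith
    have h6 : 0 ≤ 1 - q + q * Real.exp (-θ) := by
      have : 0 ≤ q * Real.exp (-θ) := by positivity
      linarith
    calc _ ≤ Real.exp (θ * x/2) * (Real.exp (-(q * (3/4*θ))))^k := by gcongr
      _ = Real.exp (θ * x/2 + k * (-(q * (3/4*θ)))) := by
        rw [← Real.exp_nat_mul, ← Real.exp_add]
      _ ≤ _ := by
        apply Real.exp_le_exp.mpr
        rw [min_eq_left (by linarith)]
        have : (k:ℝ) * (-(q * (3/4*θ))) = - (3/4 * (θ * x)) := by rw [hx]; ring
        rw [this]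
        have : 0 ≤ θ * x := by positivity
        linarith
  · have hs : sj g x = 2 := by unfold sj; rw [if_neg (by linarith)]
    rw [hs]
    have he0 : 0 ≤ 1 - Real.exp (-θ) := by linarith
    have hb : Bn q k (fun T => Real.exp (-θ * ((T + 1 - 2 : ℕ):ℝ))) ≤
        Bn q k (fun T => Real.exp (-θ) + (1 - Real.exp (-θ)) * (if T ≤ 1 then (1:ℝ) else 0)) := by
      apply Bn_mono hq0 hq1
      intro T
      by_cases hT : T ≤ 1
      · have : T + 1 - 2 = 0 := by omega
        simp [hT, this]
      · simp only [hT, if_false, mul_zero, add_zero]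
        apply Real.exp_le_exp.mpr
        have : (1:ℝ) ≤ ((T + 1 - 2 : ℕ):ℝ) := by exact_mod_cast (by omega : 1 ≤ T + 1 - 2)
        nlinarith
    rw [Bn_add, Bn_const, Bn_smul] at hb
    refine hb.trans ?_
    obtain ⟨t, rfl⟩ : ∃ t, k = t + 1 := ⟨k - 1, by omega⟩
    rw [Bn_ind1]
    have ht : (1:ℝ) ≤ t := by exact_mod_cast (by omega : 1 ≤ t)
    set y := (t:ℝ) * q with hy
    have hy0 : 0 ≤ y := by positivity
    have hyx : y ≤ x := by rw [hx, hy]; push_cast; nlinarith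
    have hxy : x ≤ 2 * y := by rw [hx, hy]; push_cast; nlinarith
    have hp : (1-q)^t ≤ Real.exp (-y) := by
      have : 1 - q ≤ Real.exp (-q) := by have := Real.add_one_le_exp (-q); linarith
      calc (1-q)^t ≤ (Real.exp (-q))^t := by gcongr
        _ = _ := by rw [← Real.exp_nat_mul]; congr 1; rw [hy]; ring
    have hp2 : Real.exp (-y) * (1+y) ≤ 1 - y^2/26 := by
      have h7 := Real.quadratic_le_exp_of_nonneg hy0
      have h8 : Real.exp (-y) ≤ 1/(1+y+y^2/2) := by
        rw [Real.exp_neg, ← one_div]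
        gcongr
      have h9 : 1/(1+y+y^2/2) * (1+y) ≤ 1 - y^2/26 := by
        rw [one_div, inv_mul_le_iff₀ (by positivity)]
        have : y ≤ 4 := by linarith
        have : (1 + y + y^2/2) ≤ 13 := by nlinarith
        nlinarith [sq_nonneg y]
      calc _ ≤ 1/(1+y+y^2/2) * (1+y) := by gcongr
        _ ≤ _ := h9
    have hP : (1-q)^t * (1+y) ≤ 1 - x^2/104 := by
      have : (1-q)^t * (1+y) ≤ Real.exp (-y) * (1+y) := by gcongr
      have : x^2 ≤ 4 * y^2 := by nlinarith
      linarith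
    have hmin : x * min 1 x ≤ x^2 := by
      rw [sq]; gcongr; exact min_le_right _ _
    have hx2 : x^2/104 ≤ 1 := by nlinarith
    calc _ ≤ Real.exp (-θ) + (1 - Real.exp (-θ)) * (1 - x^2/104) := by gcongr
      _ = 1 - (1 - Real.exp (-θ)) * (x^2/104) := by ring
      _ ≤ 1 - (3/4*θ) * (x^2/104) := by gcongr; linarith
      _ ≤ 1 + -θ * (x * min 1 x) / 208 := by
        have : θ * (x * min 1 x) ≤ θ * x^2 := by gcongr
        have : 0 ≤ θ * x^2 := by positivity
        linarith
      _ ≤ _ := by have := Real.add_one_le_exp (-θ * (x * min 1 x) / 208); linarith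

/-- Denominator. -/
noncomputable def Dn (m g : ℕ) (x e : ℝ) : ℝ :=
  m * (1 + x/g) + Real.sqrt m * (Real.sqrt x + x / Real.sqrt g) + x * e

lemma rate_x {m g : ℕ} (hm : 1 ≤ m) (hg : 2 ≤ g) {x e : ℝ} (hx : 0 ≤ x) (he : 0 ≤ e) (he1 : e ≤ 1) :
    (1/12) * ((x*e)^2 / Dn m g x e) ≤ rate e m (sj g x) * (x * min 1 x) := by
  have hm' : (1:ℝ) ≤ m := by exact_mod_cast hm
  have hg' : (2:ℝ) ≤ g := by exact_mod_cast hg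
  have hs2 : (2:ℝ) ≤ sj g x := by exact_mod_cast sj_ge hg x
  have hsx : 0 ≤ Real.sqrt x := Real.sqrt_nonneg x
  have hsm : 0 ≤ Real.sqrt m := Real.sqrt_nonneg _
  have hsg : 0 < Real.sqrt g := Real.sqrt_pos.mpr (by positivity)
  have hD : (m:ℝ) ≤ Dn m g x e := by
    unfold Dn
    have : 0 ≤ (m:ℝ) * (x/g) := by positivity
    have : 0 ≤ Real.sqrt m * (Real.sqrt x + x / Real.sqrt g) := by positivity
    have : 0 ≤ x * e := by positivity
    linarith
  have hD0 : 0 < Dn m g x e := by linarith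
  have hden : 0 < (m:ℝ)/(sj g x) + Real.sqrt (m/(sj g x)) + e := by positivity
  -- suffices
  have main : ∀ {M : ℝ}, 0 < M → x * min 1 x = x^2 / M →
      M * ((m:ℝ)/(sj g x) + Real.sqrt (m/(sj g x)) + e) ≤ 12 * Dn m g x e →
      (1/12) * ((x*e)^2 / Dn m g x e) ≤ rate e m (sj g x) * (x * min 1 x) := by
    intro M hM hMx hle
    rw [hMx]
    unfold rate
    calc (1/12) * ((x*e)^2 / Dn m g x e) = (x*e)^2 / (12 * Dn m g x e) := by field_simp
      _ ≤ (x*e)^2 / (M * ((m:ℝ)/(sj g x) + Real.sqrt (m/(sj g x)) + e)) := by gcongr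
      _ = _ := by field_simp
  rcases le_or_gt 4 x with h4 | h4
  · apply main (M := x) (by linarith)
    · rw [min_eq_left (by linarith)]; field_simp
    · have hinv : 1/(sj g x : ℝ) ≤ 4/x + 1/g := by
        have e1 : sj g x = min ⌊x/2⌋₊ g := by unfold sj; rw [if_pos h4]
        rcases le_total ⌊x/2⌋₊ g with h | h
        · rw [e1, min_eq_left h]
          have h1 := Nat.lt_floor_add_one (x/2)
          have h2 : x/4 ≤ (⌊x/2⌋₊:ℝ) := by linarith
          have : 1/(⌊x/2⌋₊:ℝ) ≤ 1/(x/4) := by gcongr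
          have e2 : 1/(x/4) = 4/x := by field_simp
          have : 0 ≤ 1/(g:ℝ) := by positivity
          linarith
        · rw [e1, min_eq_right h]
          have : 0 ≤ 4/x := by positivity
          linarith
      have a1 : x * ((m:ℝ)/(sj g x)) ≤ m * (4 + x/g) := by
        calc x * ((m:ℝ)/(sj g x)) = x * m * (1/(sj g x)) := by ring
          _ ≤ x * m * (4/x + 1/g) := by gcongr
          _ = _ := by field_simp
      have a2 : x * Real.sqrt (m/(sj g x)) ≤ Real.sqrt m * (2 * Real.sqrt x + x / Real.sqrt g) := by
        apply le_of_sq_le_sq _ (by positivity)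
        rw [mul_pow, Real.sq_sqrt (by positivity), mul_pow, Real.sq_sqrt (by positivity)]
        have b1 : x^2 * ((m:ℝ)/(sj g x)) ≤ m * (4*x + x^2/g) := by
          calc x^2 * ((m:ℝ)/(sj g x)) = x * (x * ((m:ℝ)/(sj g x))) := by ring
            _ ≤ x * (m * (4 + x/g)) := by gcongr
            _ = _ := by ring
        refine b1.trans ?_
        gcongr
        have b2 : (2 * Real.sqrt x + x / Real.sqrt g)^2 =
          4 * (Real.sqrt x)^2 + 4 * Real.sqrt x * (x / Real.sqrt g) + x^2 / (Real.sqrt g)^2 := by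
          field_simp; ring
        rw [b2, Real.sq_sqrt hx, Real.sq_sqrt (by positivity)]
        have : 0 ≤ 4 * Real.sqrt x * (x / Real.sqrt g) := by positivity
        linarith
      have e3 : x * ((m:ℝ)/(sj g x) + Real.sqrt (m/(sj g x)) + e) =
        x * ((m:ℝ)/(sj g x)) + x * Real.sqrt (m/(sj g x)) + x * e := by ring
      rw [e3]
      unfold Dn
      have c1 : 0 ≤ (m:ℝ) * (x/g) := by positivity
      have c2 : 0 ≤ Real.sqrt m * Real.sqrt x := by positivity
      have c3 : 0 ≤ Real.sqrt m * (x / Real.sqrt g) := by positivity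
      have c4 : 0 ≤ x * e := by positivity
      linarith
  · have hM : x * min 1 x = x^2 / max 1 x := by
      rcases le_total 1 x with h | h
      · rw [min_eq_left h, max_eq_right h]; field_simp
      · rw [min_eq_right h, max_eq_left h]; ring
    apply main (M := max 1 x) (by positivity) hM
    have h5 : max 1 x ≤ 4 := max_le (by norm_num) h4.le
    have a1 : (m:ℝ)/(sj g x) ≤ m := div_le_self (by linarith) (by linarith)
    have a2 : Real.sqrt (m/(sj g x)) ≤ m := by
      rw [Real.sqrt_le_iff]
      exact ⟨by linarith, by nlinarith⟩
    calc _ ≤ 4 * ((m:ℝ) + m + m) := by gcongr; linarith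
      _ ≤ _ := by linarith

lemma sum_count_len {n : ℕ} (l : List (Fin n)) : ∑ j, l.count j = l.length := by
  induction l with
  | nil => simp
  | cons a l ih =>
    simp only [List.count_cons, Finset.sum_add_distrib, ih, List.length_cons]
    simp

/-- Total statistic. -/
noncomputable def tot (g m n k : ℕ) (l : List (Fin m × Fin n)) : ℝ := ∑ j, cs g m k (colList j l)

lemma ex_tot {g m n k : ℕ} (q : Fin n → ℝ) (P : Fin n → Fin m → ℝ) (lam : ℝ) :
    ex (fun a : Fin m × Fin n => q a.2 * P a.2 a.1) k (fun l => Real.exp (lam * tot g m n k l)) =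
      ex q k (fun l => ∏ j, ex (P j) (l.count j) (fun l => Real.exp (lam * cs g m k l))) := by
  rw [← ex_columns]
  apply ex_congr
  intro l _
  rw [← Real.exp_sum, ← Finset.mul_sum]
  rfl

lemma exp_count {n k : ℕ} (c : ℝ) {l : List (Fin n)} (hl : l.length = k) :
    ∏ j, Real.exp (c * (l.count j : ℝ)) = Real.exp (c * k) := by
  rw [← Real.exp_sum, ← Finset.mul_sum]
  have := sum_count_len l
  rw [hl] at this
  rw [← this]; push_cast; rfl

lemma null_total {g m n k : ℕ} (hm : 1 ≤ m) (hg : 1 ≤ g) {lam : ℝ} (h0 : 0 ≤ lam) (h1 : lam ≤ 1)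
    {q : Fin n → ℝ} (hq : ∀ j, 0 ≤ q j) (hqs : ∑ j, q j = 1) :
    ex (fun a : Fin m × Fin n => q a.2 * (1/(m:ℝ))) k (fun l => Real.exp (lam * tot g m n k l)) ≤
      Real.exp (81 * lam^2 * (min 1 ((g:ℝ)/m) * k)) := by
  have hm' : (1:ℝ) ≤ m := by exact_mod_cast hm
  have := ex_tot (g := g) (k := k) q (fun (_ : Fin n) (_ : Fin m) => 1/(m:ℝ)) lam
  rw [this]
  calc _ ≤ ex q k (fun l => ∏ j, Real.exp (81 * lam^2 * min 1 ((g:ℝ)/m) * (l.count j : ℝ))) := by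
        apply ex_mono hq
        intro l hl
        apply Finset.prod_le_prod
        · intro j _
          exact ex_nonneg' (fun _ => by positivity) (by simp; field_simp) _ (fun l => by positivity)
        · intro j _
          have := null_col hm hg h0 h1 k (l.count j) (by rw [← hl]; exact List.count_le_length)
          refine this.trans (le_of_eq ?_)
          rw [mul_assoc (81 * lam^2)]
    _ = ex q k (fun _ => Real.exp (81 * lam^2 * min 1 ((g:ℝ)/m) * k)) := by
        apply ex_congr
        intro l hl
        rw [exp_count _ hl]
    _ = _ := by rw [ex_const hqs, mul_assoc (81 * lam^2)]

lemma alt_total {g m n k : ℕ} (hm : 1 ≤ m) (hg : 2 ≤ g) (hk : 2 ≤ k) {lam : ℝ} (h0 : 0 ≤ lam)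
    (h1 : lam ≤ 1/1312)
    {q : Fin n → ℝ} (hq : ∀ j, 0 ≤ q j) (hqs : ∑ j, q j = 1)
    {P : Fin n → Fin m → ℝ} (hP : ∀ j i, 0 ≤ P j i) (hPs : ∀ j, ∑ i, P j i = 1)
    {e : Fin n → ℝ} (he : ∀ j, e j = (1/2) * ∑ i, |P j i - 1/m|) (he1 : ∀ j, e j ≤ 1) :
    ex (fun a : Fin m × Fin n => q a.2 * P a.2 a.1) k (fun l => Real.exp (-lam * tot g m n k l)) ≤
      Real.exp (81 * lam^2 * (min 1 ((g:ℝ)/m) * k) -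
        lam / (132*208*12) * ∑ j, ((k * q j) * e j)^2 / Dn m g (k * q j) (e j)) := by
  have hq1 : ∀ i, q i ≤ 1 := fun i => by
    rw [← hqs]; exact Finset.single_le_sum (fun j _ => hq j) (Finset.mem_univ i)
  have he0 : ∀ j, 0 ≤ e j := fun j => by rw [he j]; positivity
  rw [ex_tot]
  set c := 81 * lam^2 * min 1 ((g:ℝ)/m) with hc
  set θ : Fin n → ℝ := fun j => lam/132 * rate (e j) m (sj g (k * q j)) with hθ
  have hθ0 : ∀ j, 0 ≤ θ j := fun j => by
    have := rate_nonneg (he0 j) m (sj g (k * q j))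
    simp only [hθ]; positivity
  have hθ1 : ∀ j, θ j ≤ 1/4 := fun j => by
    have a := rate_le (he0 j) m (sj g (k * q j))
    have b := rate_nonneg (he0 j) m (sj g (k * q j))
    have : rate (e j) m (sj g (k * q j)) ≤ 1 := a.trans (he1 j)
    simp only [hθ]
    nlinarith
  calc _ ≤ ex q k (fun l => Real.exp (c * k) *
          ∏ j, Real.exp (-θ j * ((l.count j + 1 - sj g (k * q j) : ℕ) : ℝ))) := by
        apply ex_mono hq
        intro l hl
        rw [← exp_count c hl, ← Finset.prod_mul_distrib]
        apply Finset.prod_le_prod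
        · intro j _
          exact ex_nonneg' (hP j) (hPs j) _ (fun l => by positivity)
        · intro j _
          have := alt_col hm h0 h1 (hP j) (hPs j) (he j) (sj_ge hg (k * q j)) (sj_le hg (k * q j)) k
            (l.count j) (by rw [← hl]; exact List.count_le_length)
          refine this.trans (le_of_eq ?_)
          rw [← Real.exp_add]
          congr 1
          simp only [hc, hθ]
          ring
    _ = Real.exp (c * k) * ex q k (fun l =>
          ∏ j, Real.exp (-θ j * ((l.count j + 1 - sj g (k * q j) : ℕ) : ℝ))) := ex_smul _ _ _ _
    _ ≤ Real.exp (c * k) * ∏ j, Bn (q j) k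
          (fun T => Real.exp (-θ j * ((T + 1 - sj g (k * q j) : ℕ) : ℝ))) := by
        gcongr
        apply ex_na hq hqs k
          (g := fun j T => Real.exp (-θ j * ((T + 1 - sj g (k * q j) : ℕ) : ℝ)))
        · intro i x; positivity
        · right
          intro j a b hab
          apply Real.exp_le_exp.mpr
          have : ((a + 1 - sj g (k * q j) : ℕ) : ℝ) ≤ ((b + 1 - sj g (k * q j) : ℕ) : ℝ) := by
            exact_mod_cast (by omega : a + 1 - sj g (k * q j) ≤ b + 1 - sj g (k * q j))
          have := hθ0 j
          nlinarith
    _ ≤ Real.exp (c * k) * ∏ j, Real.exp (-(lam/(132*208*12) *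
          (((k * q j) * e j)^2 / Dn m g (k * q j) (e j)))) := by
        gcongr with j _
        · exact fun j _ => Bn_nonneg (hq j) (hq1 j) k (fun x => by positivity)
        · refine (Bn_tail (hq j) (hq1 j) (hθ0 j) (hθ1 j) hk hg).trans (Real.exp_le_exp.mpr ?_)
          have r := rate_x hm hg (x := k * q j) (mul_nonneg (by positivity) (hq j)) (he0 j) (he1 j)
          have r2 := mul_le_mul_of_nonneg_left r (by positivity : 0 ≤ lam/(132*208))
          simp only [hθ]
          linarith
    _ = _ := by
        rw [← Real.exp_sum, ← Real.exp_add]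
        congr 1
        rw [Finset.sum_neg_distrib, ← Finset.mul_sum, hc]
        ring

/-- Signal strength. -/
noncomputable def A0 (m n k : ℕ) (ε : ℝ) : ℝ :=
  (k*ε)^2 / (2 * (m * n) + 2 * Real.sqrt (m * n * k) + k * ε)

lemma signal {g m n k : ℕ} (hm : 1 ≤ m) (hn : 1 ≤ n) (hg : 2 ≤ g) (hgk : (k:ℝ) ≤ g * n) {ε : ℝ} (hε : 0 < ε)
    (hk : 2 ≤ k)
    {q : Fin n → ℝ} (hq : ∀ j, 0 ≤ q j) (hqs : ∑ j, q j = 1)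
    {e : Fin n → ℝ} (he0 : ∀ j, 0 ≤ e j) (hε2 : ε ≤ ∑ j, q j * e j) :
    A0 m n k ε ≤ ∑ j, ((k * q j) * e j)^2 / Dn m g (k * q j) (e j) := by
  have hm' : (1:ℝ) ≤ m := by exact_mod_cast hm
  have hn' : (1:ℝ) ≤ n := by exact_mod_cast hn
  have hg' : (2:ℝ) ≤ g := by exact_mod_cast hg
  have hk' : (2:ℝ) ≤ k := by exact_mod_cast hk
  have hsg : 0 < Real.sqrt g := Real.sqrt_pos.mpr (by positivity)
  have hDpos : ∀ j, 0 < Dn m g (k * q j) (e j) := fun j => by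
    unfold Dn
    have := hq j
    have := he0 j
    positivity
  have hCS := Finset.sq_sum_div_le_sum_sq_div (Finset.univ : Finset (Fin n))
    (fun j => (k * q j) * e j) (g := fun j => Dn m g (k * q j) (e j)) (fun j _ => hDpos j)
  refine le_trans ?_ hCS
  set s := ∑ j, ((k:ℝ) * q j) * e j with hs
  have hsk : k * ε ≤ s := by
    have : s = k * ∑ j, q j * e j := by
      rw [hs, Finset.mul_sum]; exact Finset.sum_congr rfl (fun j _ => by ring)
    rw [this]; gcongr
  have hkε : 0 < k * ε := by positivity
  have hsqr : ∑ j, Real.sqrt (k * q j) ≤ Real.sqrt (n * k) := by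
    apply Real.le_sqrt_of_sq_le
    have := sq_sum_le_card_mul_sum_sq (s := (Finset.univ : Finset (Fin n))) (f := fun j => Real.sqrt (k * q j))
    refine this.trans (le_of_eq ?_)
    have e1 : ∀ j, Real.sqrt (k * q j) ^ 2 = k * q j := fun j =>
      Real.sq_sqrt (mul_nonneg (by positivity) (hq j))
    simp only [e1]
    rw [← Finset.mul_sum, hqs]; simp
  have hkg : (k:ℝ) / g ≤ n := by rw [div_le_iff₀ (by positivity)]; linarith
  have hkg2 : (k:ℝ) / Real.sqrt g ≤ Real.sqrt (n * k) := by
    apply Real.le_sqrt_of_sq_le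
    rw [div_pow, Real.sq_sqrt (by positivity)]
    calc (k:ℝ)^2 / g = k * (k/g) := by ring
      _ ≤ k * n := by gcongr
      _ = _ := by ring
  have hDsum : ∑ j, Dn m g (k * q j) (e j) ≤ 2 * (m * n) + 2 * Real.sqrt (m * n * k) + s := by
    have e1 : ∑ j, Dn m g (k * q j) (e j) =
        m * (n + k/g) + Real.sqrt m * (∑ j, Real.sqrt (k * q j) + k / Real.sqrt g) + s := by
      unfold Dn
      rw [Finset.sum_add_distrib, Finset.sum_add_distrib, ← Finset.mul_sum, ← Finset.mul_sum,
        Finset.sum_add_distrib, Finset.sum_add_distrib, ← Finset.sum_div, ← Finset.sum_div,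
        ← Finset.mul_sum, hqs]
      simp [hs]
    have e2 : Real.sqrt (m * n * k) = Real.sqrt m * Real.sqrt (n * k) := by
      rw [mul_assoc, Real.sqrt_mul (by positivity)]
    rw [e1, e2]
    calc _ ≤ m * ((n:ℝ) + n) + Real.sqrt m * (Real.sqrt (n * k) + Real.sqrt (n * k)) + s := by gcongr
      _ = _ := by ring
  have hDsum0 : 0 < ∑ j, Dn m g (k * q j) (e j) := by
    apply Finset.sum_pos (fun j _ => hDpos j)
    exact ⟨⟨0, by omega⟩, Finset.mem_univ _⟩
  have hs0 : 0 < s := by linarith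
  set W := 2 * ((m:ℝ) * n) + 2 * Real.sqrt (m * n * k) with hW
  have hW0 : 0 ≤ W := by positivity
  unfold A0
  rw [← hW]
  calc (k*ε)^2 / (W + k*ε) ≤ s^2 / (W + s) := by
        rw [div_le_div_iff₀ (by positivity) (by positivity)]
        have h1 : (k*ε)^2 ≤ s^2 := by gcongr
        have h2 : (k*ε)^2 * s ≤ s^2 * (k*ε) := by
          have : (k*ε) * s * (k*ε) ≤ (k*ε) * s * s := by gcongr
          linarith
        nlinarith
    _ ≤ _ := by gcongr

section reduction
variable {n m : ℕ}

/-- Average distribution. -/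
noncomputable def avg (p : Fin m → Fin n → ℝ) (j : Fin n) : ℝ := (1/(m:ℝ)) * ∑ i, p i j

/-- Conditional row distribution. -/
noncomputable def cnd (p : Fin m → Fin n → ℝ) (j : Fin n) (i : Fin m) : ℝ :=
  if avg p j = 0 then 1/(m:ℝ) else p i j / (m * avg p j)

lemma avg_pmf (hm : 1 ≤ m) {p : Fin m → Fin n → ℝ} (hp : ∀ i, IsPMF (p i)) : IsPMF (avg p) := by
  have hm' : (1:ℝ) ≤ m := by exact_mod_cast hm
  constructor
  · intro j
    have : 0 ≤ ∑ i, p i j := Finset.sum_nonneg (fun i _ => (hp i).1 j)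
    unfold avg; positivity
  · unfold avg
    rw [← Finset.mul_sum, Finset.sum_comm]
    simp only [(hp _).2]
    simp; field_simp

lemma avg_zero (hm : 1 ≤ m) {p : Fin m → Fin n → ℝ} (hp : ∀ i, IsPMF (p i)) {j : Fin n}
    (h : avg p j = 0) (i : Fin m) : p i j = 0 := by
  have hm' : (1:ℝ) ≤ m := by exact_mod_cast hm
  unfold avg at h
  have h2 : ∑ i, p i j = 0 := by
    rcases mul_eq_zero.mp h with h | h
    · exfalso
      have : (0:ℝ) < 1/m := by positivity
      linarith
    · exact h
  exact (Finset.sum_eq_zero_iff_of_nonneg (fun i _ => (hp i).1 j)).mp h2 i (Finset.mem_univ i)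

lemma joint_eq (hm : 1 ≤ m) {p : Fin m → Fin n → ℝ} (hp : ∀ i, IsPMF (p i)) :
    jointSampling p = fun a => avg p a.2 * cnd p a.2 a.1 := by
  have hm' : (1:ℝ) ≤ m := by exact_mod_cast hm
  funext a
  unfold jointSampling cnd
  split_ifs with h
  · rw [avg_zero hm hp h, h]; simp
  · field_simp

lemma cnd_nonneg (hm : 1 ≤ m) {p : Fin m → Fin n → ℝ} (hp : ∀ i, IsPMF (p i)) (j : Fin n) (i : Fin m) :
    0 ≤ cnd p j i := by
  have := (avg_pmf hm hp).1 j
  have := (hp i).1 j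
  unfold cnd
  split_ifs <;> positivity

lemma cnd_sum (hm : 1 ≤ m) {p : Fin m → Fin n → ℝ} (j : Fin n) :
    ∑ i, cnd p j i = 1 := by
  have hm' : (1:ℝ) ≤ m := by exact_mod_cast hm
  unfold cnd
  split_ifs with h
  · simp; field_simp
  · rw [← Finset.sum_div]
    have e : ∑ i, p i j = m * avg p j := by unfold avg; field_simp
    rw [e]
    have : (m:ℝ) * avg p j ≠ 0 := mul_ne_zero (by positivity) h
    exact div_self this

noncomputable def ecol (p : Fin m → Fin n → ℝ) (j : Fin n) : ℝ :=
  (1/2) * ∑ i, |cnd p j i - 1/m|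

lemma ecol_le (hm : 1 ≤ m) {p : Fin m → Fin n → ℝ} (hp : ∀ i, IsPMF (p i)) (j : Fin n) :
    ecol p j ≤ 1 := by
  have hm' : (1:ℝ) ≤ m := by exact_mod_cast hm
  have : ∑ i, |cnd p j i - 1/m| ≤ ∑ i, (cnd p j i + 1/m) := by
    apply Finset.sum_le_sum
    intro i _
    have h1 := cnd_nonneg hm hp j i
    have h2 : (0:ℝ) ≤ 1/m := by positivity
    rw [abs_le]; constructor <;> linarith
  rw [Finset.sum_add_distrib, cnd_sum hm] at this
  have e : ∑ i : Fin m, (1/(m:ℝ)) = 1 := by simp; field_simp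
  rw [e] at this
  unfold ecol; linarith

lemma ecol_sum (hm : 1 ≤ m) {p : Fin m → Fin n → ℝ} (hp : ∀ i, IsPMF (p i)) :
    ∑ j, avg p j * ecol p j = (1/(m:ℝ)) * ∑ i, tvDist (p i) (avg p) := by
  have hm' : (1:ℝ) ≤ m := by exact_mod_cast hm
  have cell : ∀ j i, avg p j * |cnd p j i - 1/m| = (1/(m:ℝ)) * |p i j - avg p j| := by
    intro j i
    have ha := (avg_pmf hm hp).1 j
    by_cases h : avg p j = 0
    · rw [h, avg_zero hm hp h]; simp
    · have : avg p j * |cnd p j i - 1/m| = |avg p j * (cnd p j i - 1/m)| := by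
        rw [abs_mul, abs_of_nonneg ha]
      rw [this]
      have h2 : (1/(m:ℝ)) * |p i j - avg p j| = |(1/(m:ℝ)) * (p i j - avg p j)| := by
        rw [abs_mul, abs_of_nonneg (by positivity : (0:ℝ) ≤ 1/m)]
      rw [h2]
      congr 1
      unfold cnd
      rw [if_neg h]
      field_simp
  unfold ecol tvDist
  have lhs : ∑ j, avg p j * (1/2 * ∑ i, |cnd p j i - 1/m|) =
      ∑ j, ∑ i, 1/2 * ((1/(m:ℝ)) * |p i j - avg p j|) := by
    apply Finset.sum_congr rfl
    intro j _
    rw [Finset.mul_sum, Finset.mul_sum]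
    apply Finset.sum_congr rfl
    intro i _
    rw [← cell]; ring
  rw [lhs, Finset.sum_comm, Finset.mul_sum]
  apply Finset.sum_congr rfl
  intro i _
  rw [Finset.mul_sum, Finset.mul_sum]
  apply Finset.sum_congr rfl
  intro j _
  ring

lemma joint_null (hm : 1 ≤ m) {p : Fin m → Fin n → ℝ} (h : ∀ i i' : Fin m, p i = p i') :
    jointSampling p = fun a => avg p a.2 * (1/(m:ℝ)) := by
  have hm' : (1:ℝ) ≤ m := by exact_mod_cast hm
  funext a
  unfold jointSampling avg
  have : ∑ i, p i a.2 = m * p a.1 a.2 := by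
    rw [Finset.sum_congr rfl (fun i _ => by rw [h i a.1])]
    simp
  rw [this]; field_simp

lemma joint_pmf (hm : 1 ≤ m) {p : Fin m → Fin n → ℝ} (hp : ∀ i, IsPMF (p i)) :
    IsPMF (jointSampling p) := by
  have hm' : (1:ℝ) ≤ m := by exact_mod_cast hm
  constructor
  · intro a
    have := (hp a.1).1 a.2
    unfold jointSampling; positivity
  · unfold jointSampling
    rw [Fintype.sum_prod_type]
    simp only [← Finset.sum_div, (hp _).2]
    simp; omega

end reduction

lemma ex_add' {ι : Type*} [Fintype ι] (p : ι → ℝ) (t : ℕ) (f g : List ι → ℝ) :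
    ex p t (fun l => f l + g l) = ex p t f + ex p t g := by
  simp only [ex_eq_sum, mul_add, Finset.sum_add_distrib]

lemma markov_null {ι : Type*} [Fintype ι] {p : ι → ℝ} (hp : IsPMF p) (t : ℕ) (S : List ι → ℝ)
    (thr lam : ℝ) (hl : 0 ≤ lam) :
    1 - Real.exp (-(lam * thr)) * ex p t (fun l => Real.exp (lam * S l)) ≤
      ex p t (fun l => if S l ≤ thr then 1 else 0) := by
  have e : 1 - Real.exp (-(lam * thr)) * ex p t (fun l => Real.exp (lam * S l)) =
      ex p t (fun l => 1 + (-Real.exp (-(lam * thr))) * Real.exp (lam * S l)) := by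
    rw [ex_add', ex_const hp.2, ex_smul]; ring
  rw [e]
  apply ex_mono hp.1
  intro l _
  have : -Real.exp (-(lam * thr)) * Real.exp (lam * S l) = - Real.exp (lam * (S l - thr)) := by
    rw [neg_mul, ← Real.exp_add]; congr 2; ring
  rw [this]
  split_ifs with h
  · have := Real.exp_pos (lam * (S l - thr)); linarith
  · have : 1 ≤ Real.exp (lam * (S l - thr)) :=
      Real.one_le_exp (mul_nonneg hl (by linarith))
    linarith

lemma markov_alt {ι : Type*} [Fintype ι] {p : ι → ℝ} (hp : IsPMF p) (t : ℕ) (S : List ι → ℝ)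
    (thr lam : ℝ) (hl : 0 ≤ lam) :
    ex p t (fun l => if S l ≤ thr then 1 else 0) ≤
      Real.exp (lam * thr) * ex p t (fun l => Real.exp (-lam * S l)) := by
  rw [← ex_smul]
  apply ex_mono hp.1
  intro l _
  rw [← Real.exp_add]
  split_ifs with h
  · apply Real.one_le_exp
    nlinarith
  · positivity

lemma choose_lam {A V L c : ℝ} (hA : 0 ≤ A) (hV : 0 < V) (hc : 0 < c)
    (h1 : 4 * 1312 * L ≤ c * A) (h2 : 1296 * (V * L) ≤ (c*A)^2) :
    ∃ lam, 0 ≤ lam ∧ lam ≤ 1/1312 ∧ 81 * lam^2 * V - lam * (c * A / 2) ≤ -L := by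
  refine ⟨min (1/1312) (c*A/(324*V)), le_min (by norm_num) (by positivity), min_le_left _ _, ?_⟩
  set lam := min (1/1312) (c*A/(324*V)) with hl
  have h0 : 0 ≤ lam := le_min (by norm_num) (by positivity)
  have hb : lam * (324 * V) ≤ c * A := by
    have : lam ≤ c*A/(324*V) := min_le_right _ _
    rwa [le_div_iff₀ (by positivity)] at this
  have h3 : 81 * lam^2 * V ≤ lam * (c*A)/4 := by nlinarith
  have h4 : 4 * L ≤ lam * (c * A) := by
    rcases le_total (1/1312) (c*A/(324*V)) with h | h
    · have : lam = 1/1312 := min_eq_left h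
      rw [this]; linarith
    · have : lam = c*A/(324*V) := min_eq_right h
      rw [this, div_mul_eq_mul_div, le_div_iff₀ (by positivity)]
      nlinarith
  linarith

lemma numerics {m n k g : ℕ} (hm : 1 ≤ m) (hn : 1 ≤ n) (hk : 2 ≤ k) (hg : (g:ℝ) ≤ k/n + 2)
    {ε L K C : ℝ} (hε : 0 < ε) (hε1 : ε < 1) (hL : 0 < L) (hK : 1 ≤ K) (hC : 100 * K ≤ C)
    (h1 : C^3 * (n^2 * m * L) ≤ k^3 * ε^4) (h2 : C^2 * (n * m * L) ≤ k^2 * ε^4)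
    (h3 : C * L ≤ k * ε^2) :
    K * L ≤ A0 m n k ε ∧ K * ((min 1 ((g:ℝ)/m) * k) * L) ≤ (A0 m n k ε)^2 := by
  have hm' : (1:ℝ) ≤ m := by exact_mod_cast hm
  have hn' : (1:ℝ) ≤ n := by exact_mod_cast hn
  have hk' : (2:ℝ) ≤ k := by exact_mod_cast hk
  have hC1 : 1 ≤ C := by linarith
  have hCC : 100 * K ≤ C^2 := by nlinarith
  have hCCC : 100 * K ≤ C^3 := by
    have : C^2 * 1 ≤ C^2 * C := by gcongr
    calc 100 * K ≤ C^2 * 1 := by linarith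
      _ ≤ C^2 * C := this
      _ = C^3 := by ring
  have hε2 : ε^2 ≤ 1 := by nlinarith
  have hε4 : ε^4 ≤ ε^2 := by
    calc ε^4 = ε^2 * ε^2 := by ring
      _ ≤ 1 * ε^2 := by gcongr
      _ = ε^2 := one_mul _
  have hmn : (1:ℝ) ≤ m * n := by nlinarith
  have hkε : 0 < k * ε := by positivity
  rcases le_or_gt (k:ℝ) (m * n) with hkmn | hkmn
  · have hD : 2 * ((m:ℝ) * n) + 2 * Real.sqrt (m * n * k) + k * ε ≤ 5 * (m * n) := by
      have a1 : Real.sqrt (m * n * k) ≤ m * n := by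
        rw [Real.sqrt_le_iff]
        refine ⟨by positivity, ?_⟩
        rw [sq]; gcongr
      have a2 : k * ε ≤ m * n := by nlinarith
      linarith
    have hA : (k*ε)^2 / (5 * (m * n)) ≤ A0 m n k ε := by unfold A0; gcongr
    constructor
    · refine le_trans ?_ hA
      rw [le_div_iff₀ (by positivity)]
      have : 0 ≤ n * m * L := by positivity
      have h4 : 100 * K * (n * m * L) ≤ C^2 * (n * m * L) := by gcongr
      have h5 : (k:ℝ)^2 * ε^4 ≤ k^2 * ε^2 := by gcongr
      have h6 : 0 ≤ K * (n * m * L) := by positivity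
      nlinarith
    · have hA2 : ((k*ε)^2 / (5 * (m * n)))^2 ≤ (A0 m n k ε)^2 := by gcongr
      refine le_trans ?_ hA2
      rw [div_pow, le_div_iff₀ (by positivity)]
      have hV : min 1 ((g:ℝ)/m) ≤ (k/n + 2)/m := (min_le_right _ _).trans (by gcongr)
      calc K * ((min 1 ((g:ℝ)/m) * k) * L) * (5 * (m * n))^2
          ≤ K * (((k/n + 2)/m * k) * L) * (5 * (m * n))^2 := by gcongr
        _ = k^2 * (25 * K * (n * m * L)) + k * (50 * K * (n^2 * m * L)) := by field_simp; ring
        _ ≤ k^2 * ((C^2/2) * (n * m * L)) + k * ((C^3/2) * (n^2 * m * L)) := by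
          gcongr <;> linarith
        _ = k^2 * ((C^2 * (n * m * L))/2) + k * ((C^3 * (n^2 * m * L))/2) := by ring
        _ ≤ k^2 * ((k^2 * ε^4)/2) + k * ((k^3 * ε^4)/2) := by gcongr
        _ = ((k*ε)^2)^2 := by ring
  · have hV : min 1 ((g:ℝ)/m) * k ≤ k := by
      calc min 1 ((g:ℝ)/m) * k ≤ 1 * k := by gcongr; exact min_le_left _ _
        _ = k := one_mul _
    have hA0 : 0 ≤ A0 m n k ε := by unfold A0; positivity
    set r := Real.sqrt (m * n * k) with hr
    have hr2 : r^2 = m * n * k := Real.sq_sqrt (by positivity)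
    have hr0 : 0 < r := Real.sqrt_pos.mpr (by positivity)
    have hmr : (m:ℝ) * n ≤ r := by
      apply Real.le_sqrt_of_sq_le
      rw [sq]; gcongr
    have key : K * (k * L) ≤ (A0 m n k ε)^2 := by
      rcases le_total (k * ε) (4 * r) with h | h
      · have hA : (k*ε)^2 / (8 * r) ≤ A0 m n k ε := by
          unfold A0; rw [← hr]; gcongr; linarith
        have hA2 : ((k*ε)^2 / (8 * r))^2 ≤ (A0 m n k ε)^2 := by gcongr
        refine le_trans ?_ hA2
        rw [div_pow, le_div_iff₀ (by positivity), mul_pow 8 r, hr2]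
        calc K * (k * L) * (8^2 * (m * n * k)) = k^2 * (64 * K * (n * m * L)) := by ring
          _ ≤ k^2 * (C^2 * (n * m * L)) := by gcongr; linarith
          _ ≤ k^2 * (k^2 * ε^4) := by gcongr
          _ = _ := by ring
      · have hA : k * ε / 2 ≤ A0 m n k ε := by
          have : (k*ε)^2 / (2 * (k*ε)) ≤ A0 m n k ε := by
            unfold A0; rw [← hr]; gcongr; linarith
          refine le_trans (le_of_eq ?_) this
          field_simp
        have hA2 : (k * ε / 2)^2 ≤ (A0 m n k ε)^2 := by gcongr
        refine le_trans ?_ hA2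
        calc K * (k * L) = k * (K * L) := by ring
          _ ≤ k * (C * L / 4) := by
            gcongr
            have : 0 ≤ L := hL.le
            nlinarith
          _ ≤ k * (k * ε^2 / 4) := by gcongr
          _ = _ := by ring
    constructor
    · apply le_of_sq_le_sq _ hA0
      refine le_trans ?_ key
      have hkL : K * L ≤ k := by
        have : K * L ≤ C * L := by gcongr; linarith
        nlinarith
      calc (K*L)^2 = K * (K * L * L) := by ring
        _ ≤ _ := by gcongr
    · refine le_trans ?_ key
      gcongr

lemma final_bound {m n k g : ℕ} (hm : 1 ≤ m) (hn : 1 ≤ n) (hk : 2 ≤ k) (hg2 : 2 ≤ g)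
    (hgk : (k:ℝ) ≤ g * n) {ε L δ : ℝ} (hε : 0 < ε) (hδ : δ = Real.exp (-L))
    (hA1 : 1296 * 329472^2 * L ≤ A0 m n k ε) (hL : 0 < L)
    (hA2 : 1296 * 329472^2 * ((min 1 ((g:ℝ)/m) * k) * L) ≤ (A0 m n k ε)^2) :
    ∃ A : (Fin k → Fin m × Fin n) → ℝ,
          (∀ x, 0 ≤ A x ∧ A x ≤ 1) ∧
          ∀ p : Fin m → Fin n → ℝ, (∀ i, IsPMF (p i)) →
            ((∀ i i' : Fin m, p i = p i') → 1 - δ ≤ acceptProb1 (jointSampling p) A) ∧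
            ((∀ q : Fin n → ℝ, IsPMF q → ε ≤ (1 / (m : ℝ)) * ∑ i, tvDist (p i) q) →
              acceptProb1 (jointSampling p) A ≤ δ) := by
  have hm' : (1:ℝ) ≤ m := by exact_mod_cast hm
  have hk' : (2:ℝ) ≤ k := by exact_mod_cast hk
  have hg' : (2:ℝ) ≤ g := by exact_mod_cast hg2
  set a := A0 m n k ε with ha
  set V := min 1 ((g:ℝ)/m) * k with hV
  have hV0 : 0 < V := by
    have : 0 < min 1 ((g:ℝ)/m) := lt_min (by norm_num) (by positivity)
    positivity
  obtain ⟨lam, hl0, hl1, hl⟩ := choose_lam (A := a) (V := V) (L := L) (c := 1/329472)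
    (by linarith) hV0 (by norm_num) (by linarith) (by
      rw [mul_pow]
      have : (0:ℝ) < 329472^2 := by norm_num
      rw [one_div, inv_pow, inv_mul_eq_div, le_div_iff₀ this]
      linarith)
  set thr := 1/329472 * a / 2 with hthr
  refine ⟨fun x => if tot g m n k (List.ofFn x) ≤ thr then 1 else 0, ?_, ?_⟩
  · intro x
    show (0:ℝ) ≤ (if tot g m n k (List.ofFn x) ≤ thr then 1 else 0) ∧
      (if tot g m n k (List.ofFn x) ≤ thr then (1:ℝ) else 0) ≤ 1
    split_ifs <;> norm_num
  intro p hp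
  have hacc : acceptProb1 (k := k) (jointSampling p)
      (fun x => if tot g m n k (List.ofFn x) ≤ thr then 1 else 0) =
      ex (jointSampling p) k (fun l => if tot g m n k l ≤ thr then 1 else 0) := by
    rw [ex_eq_sum]; rfl
  rw [hacc]
  have hj := joint_pmf hm hp
  have hav := avg_pmf hm hp
  constructor
  · intro hnull
    refine le_trans ?_ (markov_null hj k (tot g m n k) thr lam hl0)
    have b : ex (jointSampling p) k (fun l => Real.exp (lam * tot g m n k l)) ≤
        Real.exp (81 * lam^2 * V) := by
      rw [joint_null hm hnull]
      exact null_total hm (by omega) hl0 (by linarith) hav.1 hav.2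
    have : Real.exp (-(lam * thr)) * ex (jointSampling p) k (fun l => Real.exp (lam * tot g m n k l))
        ≤ δ := by
      calc _ ≤ Real.exp (-(lam * thr)) * Real.exp (81 * lam^2 * V) := by gcongr
        _ = Real.exp (-(lam * thr) + 81 * lam^2 * V) := by rw [Real.exp_add]
        _ ≤ δ := by
          rw [hδ]; apply Real.exp_le_exp.mpr
          linarith
    linarith
  · intro halt
    refine (markov_alt hj k (tot g m n k) thr lam hl0).trans ?_
    have hsig := signal (e := ecol p) hm hn hg2 hgk hε hk hav.1 hav.2
      (fun j => by unfold ecol; positivity) (by rw [ecol_sum hm hp]; exact halt _ hav)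
    have b := alt_total (g := g) (k := k) hm hg2 hk hl0 hl1 hav.1 hav.2
      (cnd_nonneg hm hp) (fun j => cnd_sum hm (p := p) j) (e := ecol p) (fun j => rfl) (ecol_le hm hp)
    rw [← joint_eq hm hp] at b
    calc _ ≤ Real.exp (lam * thr) * Real.exp (81 * lam^2 * V - lam / (132*208*12) *
          ∑ j, ((k * avg p j) * ecol p j)^2 / Dn m g (k * avg p j) (ecol p j)) := by gcongr
      _ ≤ Real.exp (lam * thr) * Real.exp (81 * lam^2 * V - lam / (132*208*12) * a) := by
        gcongr
      _ = Real.exp (lam * thr + (81 * lam^2 * V - lam / (132*208*12) * a)) := by rw [Real.exp_add]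
      _ ≤ δ := by
        rw [hδ]; apply Real.exp_le_exp.mpr
        have : lam / (132*208*12) * a = 2 * (lam * thr) := by rw [hthr]; ring
        rw [this]
        linarith

lemma trivial_tester {m n k : ℕ} (hm : 1 ≤ m) {ε δ : ℝ} (hδ : 1/2 ≤ δ) :
    ∃ A : (Fin k → Fin m × Fin n) → ℝ,
          (∀ x, 0 ≤ A x ∧ A x ≤ 1) ∧
          ∀ p : Fin m → Fin n → ℝ, (∀ i, IsPMF (p i)) →
            ((∀ i i' : Fin m, p i = p i') → 1 - δ ≤ acceptProb1 (jointSampling p) A) ∧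
            ((∀ q : Fin n → ℝ, IsPMF q → ε ≤ (1 / (m : ℝ)) * ∑ i, tvDist (p i) q) →
              acceptProb1 (jointSampling p) A ≤ δ) := by
  refine ⟨fun _ => 1/2, fun x => by norm_num, fun p hp => ?_⟩
  have hacc : acceptProb1 (k := k) (jointSampling p) (fun _ => 1/2) = 1/2 := by
    have := ex_const (joint_pmf hm hp).2 (1/2) k
    rw [ex_eq_sum] at this
    exact this
  rw [hacc]
  exact ⟨fun _ => by linarith, fun _ => by linarith⟩

/-- Testing collections of distributions, upper bound (Theorem 1.4, upper-bound part). -/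
theorem collections_testing_upper_bound :
    ∃ C > (0 : ℝ), ∀ n m : ℕ, 1 ≤ n → 1 ≤ m →
      ∀ ε δ : ℝ, 0 < ε → ε < 1 → 0 < δ → δ < 1 →
      ∀ k : ℕ,
        k = ⌈C * ((n : ℝ) ^ ((2 : ℝ) / 3) * (m : ℝ) ^ ((1 : ℝ) / 3)
                * Real.log (1 / δ) ^ ((1 : ℝ) / 3) / ε ^ ((4 : ℝ) / 3)
              + (((n : ℝ) * (m : ℝ) * Real.log (1 / δ)) ^ ((1 : ℝ) / 2)
                  + Real.log (1 / δ)) / ε ^ 2)⌉₊ →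
        ∃ A : (Fin k → Fin m × Fin n) → ℝ,
          (∀ x, 0 ≤ A x ∧ A x ≤ 1) ∧
          ∀ p : Fin m → Fin n → ℝ, (∀ i, IsPMF (p i)) →
            ((∀ i i' : Fin m, p i = p i') → 1 - δ ≤ acceptProb1 (jointSampling p) A) ∧
            ((∀ q : Fin n → ℝ, IsPMF q → ε ≤ (1 / (m : ℝ)) * ∑ i, tvDist (p i) q) →
              acceptProb1 (jointSampling p) A ≤ δ) := by
  refine ⟨100 * (1296 * 329472^2), by norm_num, ?_⟩
  intro n m hn hm ε δ hε hε1 hδ hδ1 k hk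
  rcases le_or_gt (1/2) δ with hhalf | hhalf
  · exact trivial_tester hm hhalf
  have hm' : (1:ℝ) ≤ m := by exact_mod_cast hm
  have hn' : (1:ℝ) ≤ n := by exact_mod_cast hn
  set L := Real.log (1/δ) with hLdef
  have hδL : δ = Real.exp (-L) := by
    rw [hLdef, one_div, Real.log_inv, neg_neg, Real.exp_log hδ]
  have hL2 : 1/2 ≤ L := by
    have h1 : Real.log 2 ≤ L := by
      apply Real.log_le_log (by norm_num)
      rw [le_div_iff₀ hδ]; linarith
    have := Real.log_two_gt_d9
    linarith
  have hL : 0 < L := by linarith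
  set K : ℝ := 1296 * 329472^2 with hK
  have hK1 : 1 ≤ K := by rw [hK]; norm_num
  set X := (n : ℝ) ^ ((2 : ℝ) / 3) * (m : ℝ) ^ ((1 : ℝ) / 3) * L ^ ((1 : ℝ) / 3) / ε ^ ((4 : ℝ) / 3) with hX
  set Y := ((n : ℝ) * (m : ℝ) * L) ^ ((1 : ℝ) / 2) with hY
  have hX0 : 0 ≤ X := by positivity
  have hY0 : 0 ≤ Y := by positivity
  have hkge : 100 * K * (X + (Y + L)/ε^2) ≤ k := by
    rw [hk]; exact Nat.le_ceil _
  have pw : ∀ (a b : ℝ) (c : ℕ), 0 ≤ a → (a ^ b) ^ c = a ^ (b * c) := fun a b c ha => by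
    rw [← Real.rpow_natCast, ← Real.rpow_mul ha]
  have hX3 : X^3 * ε^4 = n^2 * m * L := by
    rw [hX, div_pow, mul_pow, mul_pow, pw _ _ _ (by positivity), pw _ _ _ (by positivity),
      pw _ _ _ (by positivity), pw _ _ _ (by positivity)]
    have e1 : (2:ℝ)/3 * (3:ℕ) = (2:ℕ) := by norm_num
    have e2 : (1:ℝ)/3 * (3:ℕ) = 1 := by norm_num
    have e3 : (4:ℝ)/3 * (3:ℕ) = (4:ℕ) := by norm_num
    rw [e1, e2, e3, Real.rpow_one, Real.rpow_one, Real.rpow_natCast, Real.rpow_natCast]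
    field_simp
  have hY2 : Y^2 = n * m * L := by
    rw [hY, pw _ _ _ (by positivity)]
    have e1 : (1:ℝ)/2 * (2:ℕ) = 1 := by norm_num
    rw [e1, Real.rpow_one]
  have hYε : 0 ≤ Y/ε^2 := by positivity
  have hLε : 0 ≤ L/ε^2 := by positivity
  rw [add_div] at hkge
  have k1 : 100 * K * X ≤ k := by
    refine le_trans ?_ hkge; gcongr; linarith
  have k2 : 100 * K * (Y/ε^2) ≤ k := by
    refine le_trans ?_ hkge; gcongr; linarith
  have k3 : 100 * K * (L/ε^2) ≤ k := by
    refine le_trans ?_ hkge; gcongr; linarith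
  have h3 : 100 * K * L ≤ k * ε^2 := by
    rw [← mul_div_assoc, div_le_iff₀ (by positivity)] at k3; exact k3
  have h2 : (100*K)^2 * (n * m * L) ≤ k^2 * ε^4 := by
    rw [← mul_div_assoc, div_le_iff₀ (by positivity)] at k2
    calc (100*K)^2 * (n * m * L) = (100 * K * Y)^2 := by rw [← hY2]; ring
      _ ≤ (k * ε^2)^2 := by gcongr
      _ = _ := by ring
  have h1 : (100*K)^3 * (n^2 * m * L) ≤ k^3 * ε^4 := by
    calc (100*K)^3 * (n^2 * m * L) = (100 * K * X)^3 * ε^4 := by rw [← hX3]; ring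
      _ ≤ k^3 * ε^4 := by gcongr
  have hk2 : 2 ≤ k := by
    have hε2 : ε^2 ≤ 1 := by nlinarith
    have : (2:ℝ) ≤ k := by
      have : (k:ℝ) * ε^2 ≤ k * 1 := by gcongr
      nlinarith
    exact_mod_cast this
  have hgk : (k:ℝ) ≤ ((k/n + 2 : ℕ):ℝ) * n := by
    have := Nat.lt_div_mul_add (a := k) (b := n) (by omega)
    have h4 : k ≤ (k/n + 2) * n := by
      rw [add_mul]; omega
    exact_mod_cast h4
  have hg : ((k/n + 2 : ℕ):ℝ) ≤ k/n + 2 := by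
    push_cast
    have := Nat.cast_div_le (α := ℝ) (m := k) (n := n)
    linarith
  obtain ⟨r1, r2⟩ := numerics hm hn hk2 hg hε hε1 hL hK1 le_rfl h1 h2 h3
  exact final_bound hm hn hk2 (Nat.le_add_left 2 _) hgk hε hδL r1 hL r2
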